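/- For every ranked alphabet Σ and every k ≥ 1, the family of tree languages over Σ accepted by nondeterministic k-head tree-walking automata with nested pebbles equals the family of tree languages definable in first-order logic with positive occurrences of k-ary transitive closure: NPTWA^k = FO+posTC^k. -/

import Mathlib

namespace NestedPebbles

/-- Trees over a ranked alphabet `(Sig, rank)`: terms `σ(t₁,…,tₙ)` with `rank σ = n`. -/
inductive RTree (Sig : Type) (rank : Sig → ℕ) : Type
  | node (a : Sig) (children : Fin (rank a) → RTree Sig rank) : RTree Sig rank

namespace RTree

variable {Sig : Type} {rank : Sig → ℕ}

/-- The label of the root symbol. -/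
def label : RTree Sig rank → Sig
  | node a _ => a

/-- The `i`-th (0-based) immediate subtree, if it exists. -/
def child : RTree Sig rank → ℕ → Option (RTree Sig rank)
  | node a c, i => if h : i < rank a then some (c ⟨i, h⟩) else none

/-- The subtree at a position (a list of 0-based child indices, read from the root). -/
def subtree : RTree Sig rank → List ℕ → Option (RTree Sig rank)
  | t, [] => some t
  | t, i :: p => (t.child i).bind fun s => s.subtree p

end RTree

variable {Sig : Type} {rank : Sig → ℕ}

/-- `p` is (the address of) a node of `t`. -/
def IsPos (t : RTree Sig rank) (p : List ℕ) : Prop := (t.subtree p).isSome = true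

/-- The type of nodes of a tree `t`, as valid positions. -/
def Pos (t : RTree Sig rank) : Type := { p : List ℕ // IsPos t p }

/-- The root node. -/
def rootPos (t : RTree Sig rank) : Pos t := ⟨[], rfl⟩

/-- The label of the node of `t` at position `p`. -/
def labelAt (t : RTree Sig rank) (p : List ℕ) : Option Sig := (t.subtree p).map RTree.label

/-- The child number of a node: `0` for the root, and `j` for a `j`-th child (1-based). -/
def childNo (p : List ℕ) : ℕ :=
  match p.getLast? with
  | none => 0
  | some j => j + 1

/-!  ### First-order logic with k-ary transitive closure, on trees  -/

/-- First-order formulas over a ranked alphabet, with a `k`-ary transitive closure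
operator.  Variables are natural numbers.  `lab a x` means `x` has label `a`;
`edg i x y` means `y` is the `i`-th child of `x` (`i` is 1-based);
`le x y` means `x` is an ancestor of `y`; `tc xs ys φ us vs` is the transitive
closure `φ*` of `φ` with respect to the tuples of variables `xs`, `ys` (which it
binds), applied to the tuples of variables `us`, `vs`. -/
inductive TForm (Sig : Type) (rank : Sig → ℕ) (k : ℕ) : Type
  | lab (a : Sig) (x : ℕ)
  | edg (i : ℕ) (x y : ℕ)
  | le (x y : ℕ)
  | eq (x y : ℕ)
  | not (φ : TForm Sig rank k)
  | and (φ ψ : TForm Sig rank k)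
  | or (φ ψ : TForm Sig rank k)
  | ex (x : ℕ) (φ : TForm Sig rank k)
  | all (x : ℕ) (φ : TForm Sig rank k)
  | tc (xs ys : Fin k → ℕ) (φ : TForm Sig rank k) (us vs : Fin k → ℕ)

/-- Update a valuation on a tuple of variables simultaneously. -/
noncomputable def updVec {α : Type} {k : ℕ} (ν : ℕ → α) (xs : Fin k → ℕ) (a : Fin k → α) :
    ℕ → α :=
  fun n => if h : ∃ i, xs i = n then a h.choose else ν n

/-- Satisfaction of a formula in a tree `t` under a valuation of the variables by
nodes of `t`. -/
def Sat {k : ℕ} (t : RTree Sig rank) : TForm Sig rank k → (ℕ → Pos t) → Prop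
  | .lab a x, ν => labelAt t (ν x).1 = some a
  | .edg i x y, ν => 1 ≤ i ∧ (ν y).1 = (ν x).1 ++ [i - 1]
  | .le x y, ν => (ν x).1 <+: (ν y).1
  | .eq x y, ν => ν x = ν y
  | .not φ, ν => ¬ Sat t φ ν
  | .and φ ψ, ν => Sat t φ ν ∧ Sat t ψ ν
  | .or φ ψ, ν => Sat t φ ν ∨ Sat t ψ ν
  | .ex x φ, ν => ∃ u : Pos t, Sat t φ (Function.update ν x u)
  | .all x φ, ν => ∀ u : Pos t, Sat t φ (Function.update ν x u)
  | .tc xs ys φ us vs, ν =>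
      Relation.ReflTransGen
        (fun a b : Fin k → Pos t => Sat t φ (updVec (updVec ν xs a) ys b))
        (fun i => ν (us i)) (fun i => ν (vs i))

/-- The free variables of a formula. -/
def freeVars {k : ℕ} : TForm Sig rank k → Set ℕ
  | .lab _ x => {x}
  | .edg _ x y => {x, y}
  | .le x y => {x, y}
  | .eq x y => {x, y}
  | .not φ => freeVars φ
  | .and φ ψ => freeVars φ ∪ freeVars ψ
  | .or φ ψ => freeVars φ ∪ freeVars ψ
  | .ex x φ => freeVars φ \ {x}
  | .all x φ => freeVars φ \ {x}
  | .tc xs ys φ us vs =>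
      (freeVars φ \ (Set.range xs ∪ Set.range ys)) ∪ Set.range us ∪ Set.range vs

/-- Two `k`-tuples of variables consist of `2k` pairwise distinct variables. -/
def Distinct2 {k : ℕ} (xs ys : Fin k → ℕ) : Prop :=
  Function.Injective xs ∧ Function.Injective ys ∧ ∀ i j, xs i ≠ ys j

/-- `φ` is functional in the tuples of variables `xs`, `ys`: for every tree, every
valuation of the remaining variables, and every value of `xs`, there is at most one
value of `ys` satisfying `φ`. -/
def FunctionalIn {k : ℕ} (φ : TForm Sig rank k) (xs ys : Fin k → ℕ) : Prop :=
  ∀ (t : RTree Sig rank) (ν : ℕ → Pos t) (a b b' : Fin k → Pos t),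
    Sat t φ (updVec (updVec ν xs a) ys b) →
    Sat t φ (updVec (updVec ν xs a) ys b') → b = b'

/-- Well-formedness: in each transitive closure the `2k` bound variables are
pairwise distinct and occur free in the body. -/
def WF {k : ℕ} : TForm Sig rank k → Prop
  | .not φ => WF φ
  | .and φ ψ => WF φ ∧ WF ψ
  | .or φ ψ => WF φ ∧ WF ψ
  | .ex _ φ => WF φ
  | .all _ φ => WF φ
  | .tc xs ys φ _ _ =>
      Distinct2 xs ys ∧ (Set.range xs ∪ Set.range ys) ⊆ freeVars φ ∧ WF φ
  | _ => True

/-- All transitive closures occurring in the formula are deterministic, i.e., applied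
to functional formulas. -/
def DetTC {k : ℕ} : TForm Sig rank k → Prop
  | .not φ => DetTC φ
  | .and φ ψ => DetTC φ ∧ DetTC ψ
  | .or φ ψ => DetTC φ ∧ DetTC ψ
  | .ex _ φ => DetTC φ
  | .all _ φ => DetTC φ
  | .tc xs ys φ _ _ => FunctionalIn φ xs ys ∧ DetTC φ
  | _ => True

/-- All occurrences of transitive closure are positive (within the scope of an even
number of negations); the polarity parameter `b` is `true` for an even number. -/
def PosTC {k : ℕ} : Bool → TForm Sig rank k → Prop
  | b, .not φ => PosTC (!b) φ
  | b, .and φ ψ => PosTC b φ ∧ PosTC b ψ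
  | b, .or φ ψ => PosTC b φ ∧ PosTC b ψ
  | b, .ex _ φ => PosTC b φ
  | b, .all _ φ => PosTC b φ
  | b, .tc _ _ φ _ _ => b = true ∧ PosTC b φ
  | _, _ => True

/-- The formula contains no transitive closure operator (pure first-order). -/
def TCFree {k : ℕ} : TForm Sig rank k → Prop
  | .not φ => TCFree φ
  | .and φ ψ => TCFree φ ∧ TCFree ψ
  | .or φ ψ => TCFree φ ∧ TCFree ψ
  | .ex _ φ => TCFree φ
  | .all _ φ => TCFree φ
  | .tc _ _ _ _ _ => False
  | _ => True

/-- The tree language defined by a (closed) formula. -/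
def treesOf {k : ℕ} (φ : TForm Sig rank k) : Set (RTree Sig rank) :=
  {t | Sat t φ fun _ => rootPos t}

/-- `FO+DTC^k`: tree languages definable by closed first-order formulas with `k`-ary
deterministic transitive closure. -/
def FODTC (Sig : Type) (rank : Sig → ℕ) (k : ℕ) : Set (Set (RTree Sig rank)) :=
  {L | ∃ φ : TForm Sig rank k, WF φ ∧ DetTC φ ∧ freeVars φ = ∅ ∧ L = treesOf φ}

/-- `FO+TC^k`: tree languages definable by closed first-order formulas with `k`-ary
transitive closure. -/
def FOTC (Sig : Type) (rank : Sig → ℕ) (k : ℕ) : Set (Set (RTree Sig rank)) :=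
  {L | ∃ φ : TForm Sig rank k, WF φ ∧ freeVars φ = ∅ ∧ L = treesOf φ}

/-- `FO+posTC^k`: tree languages definable by closed first-order formulas in which
every occurrence of the `k`-ary transitive closure operator is positive. -/
def FOposTC (Sig : Type) (rank : Sig → ℕ) (k : ℕ) : Set (Set (RTree Sig rank)) :=
  {L | ∃ φ : TForm Sig rank k, WF φ ∧ PosTC true φ ∧ freeVars φ = ∅ ∧ L = treesOf φ}

/-!  ### k-head tree-walking automata with nested pebbles  -/

/-- Tests of a `k`-head tree-walking automaton with pebble set `X`:
label of the node under head `i`, presence of pebble `x` at head `i`, and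
child number of the node under head `i`. -/
inductive TTest (Sig : Type) (k : ℕ) (X : Type) : Type
  | lab (i : Fin k) (a : Sig)
  | peb (i : Fin k) (x : X)
  | chno (i : Fin k) (j : ℕ)

/-- Instructions: move head `i` up / down to the `j`-th child (1-based), drop a
pebble at head `i`, retrieve the most recently dropped pebble (from a distance),
or perform a positive (`b = true`) or negated (`b = false`) test. -/
inductive TInstr (Sig : Type) (k : ℕ) (X : Type) : Type
  | up (i : Fin k)
  | down (i : Fin k) (j : ℕ)
  | dropPeb (i : Fin k) (x : X)
  | retrieve (x : X)
  | test (b : Bool) (τ : TTest Sig k X)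

/-- A `k`-head tree-walking automaton with nested pebbles: a finite state set `Q`,
a finite pebble set `X`, an initial state, accepting states, and a finite set of
instructions `⟨p, χ, q⟩`. -/
structure TWA (Sig : Type) (rank : Sig → ℕ) (k : ℕ) : Type 1 where
  Q : Type
  finQ : Fintype Q
  X : Type
  finX : Fintype X
  q0 : Q
  acc : Set Q
  instr : Set (Q × TInstr Sig k X × Q)
  instrFin : instr.Finite

/-- Configurations: a state, the positions of the `k` heads, and the stack of
dropped pebbles with their positions (most recent first). -/
abbrev TConf {Sig : Type} {rank : Sig → ℕ} {k : ℕ} (A : TWA Sig rank k)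
    (t : RTree Sig rank) : Type :=
  A.Q × (Fin k → Pos t) × List (A.X × Pos t)

/-- Semantics of tests. -/
def testHolds {k : ℕ} (t : RTree Sig rank) {X : Type} (τ : TTest Sig k X)
    (hs : Fin k → Pos t) (π : List (X × Pos t)) : Prop :=
  match τ with
  | .lab i a => labelAt t (hs i).1 = some a
  | .peb i x => (x, hs i) ∈ π
  | .chno i j => childNo (hs i).1 = j

/-- Semantics of a single instruction, relating head positions and pebble stacks
before and after. -/
def instrStep {k : ℕ} (t : RTree Sig rank) {X : Type} (ins : TInstr Sig k X)
    (hs : Fin k → Pos t) (π : List (X × Pos t))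
    (hs' : Fin k → Pos t) (π' : List (X × Pos t)) : Prop :=
  match ins with
  | .up i => π' = π ∧ (∃ j : ℕ, (hs i).1 = (hs' i).1 ++ [j]) ∧ ∀ h, h ≠ i → hs' h = hs h
  | .down i j => π' = π ∧ 1 ≤ j ∧ (hs' i).1 = (hs i).1 ++ [j - 1] ∧ ∀ h, h ≠ i → hs' h = hs h
  | .dropPeb i x => hs' = hs ∧ π' = (x, hs i) :: π ∧ ∀ w, (x, w) ∉ π
  | .retrieve x => hs' = hs ∧ ∃ w, π = (x, w) :: π'
  | .test b τ => hs' = hs ∧ π' = π ∧ (testHolds t τ hs π ↔ b = true)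

/-- The step relation of automaton `A` on tree `t`. -/
def Step {k : ℕ} (A : TWA Sig rank k) (t : RTree Sig rank) :
    TConf A t → TConf A t → Prop :=
  fun c c' => ∃ ins : TInstr Sig k A.X,
    (c.1, ins, c'.1) ∈ A.instr ∧ instrStep t ins c.2.1 c.2.2 c'.2.1 c'.2.2

/-- `χ'` is the negation of the test `χ`. -/
def negOf {k : ℕ} {X : Type} (χ χ' : TInstr Sig k X) : Prop :=
  ∃ b τ, χ = TInstr.test b τ ∧ χ' = TInstr.test (!b) τ

/-- Determinism: any two distinct instructions with the same source state consist
of a test and its negation. -/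
def Deterministic {k : ℕ} (A : TWA Sig rank k) : Prop :=
  ∀ p χ₁ q₁ χ₂ q₂, (p, χ₁, q₁) ∈ A.instr → (p, χ₂, q₂) ∈ A.instr →
    (χ₁, q₁) ≠ (χ₂, q₂) → negOf χ₁ χ₂ ∨ negOf χ₂ χ₁

/-- The initial configuration: initial state, all heads at the root, no pebbles. -/
def initConf {k : ℕ} (A : TWA Sig rank k) (t : RTree Sig rank) : TConf A t :=
  (A.q0, fun _ => rootPos t, [])

/-- A configuration is halting if no step is possible from it. -/
def HaltingConf {k : ℕ} (A : TWA Sig rank k) (t : RTree Sig rank) (c : TConf A t) : Prop :=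
  ∀ c', ¬ Step A t c c'

/-- Acceptance: some computation from the initial configuration halts in an
accepting state with all heads at the root and no pebbles on the tree. -/
def Accepts {k : ℕ} (A : TWA Sig rank k) (t : RTree Sig rank) : Prop :=
  ∃ q ∈ A.acc,
    Relation.ReflTransGen (Step A t) (initConf A t) (q, fun _ => rootPos t, []) ∧
    HaltingConf A t (q, fun _ => rootPos t, [])

/-- The tree language accepted by `A`. -/
def Lang {k : ℕ} (A : TWA Sig rank k) : Set (RTree Sig rank) := {t | Accepts A t}

/-- The automaton uses no pebbles at all. -/
def PebbleFree {k : ℕ} (A : TWA Sig rank k) : Prop :=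
  ∀ p χ q, (p, χ, q) ∈ A.instr →
    (∀ i x, χ ≠ TInstr.dropPeb i x) ∧ (∀ x, χ ≠ TInstr.retrieve x) ∧
    (∀ b i x, χ ≠ TInstr.test b (TTest.peb i x))

/-- `DPTWA^k`: tree languages accepted by deterministic `k`-head tree-walking
automata with nested pebbles. -/
def DPTWA (Sig : Type) (rank : Sig → ℕ) (k : ℕ) : Set (Set (RTree Sig rank)) :=
  {L | ∃ A : TWA Sig rank k, Deterministic A ∧ L = Lang A}

/-- `NPTWA^k`: tree languages accepted by nondeterministic `k`-head tree-walking
automata with nested pebbles. -/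
def NPTWA (Sig : Type) (rank : Sig → ℕ) (k : ℕ) : Set (Set (RTree Sig rank)) :=
  {L | ∃ A : TWA Sig rank k, L = Lang A}

/-- `NTWA^k`: tree languages accepted by nondeterministic `k`-head tree-walking
automata without pebbles. -/
def NTWA (Sig : Type) (rank : Sig → ℕ) (k : ℕ) : Set (Set (RTree Sig rank)) :=
  {L | ∃ A : TWA Sig rank k, PebbleFree A ∧ L = Lang A}

end NestedPebbles

namespace NestedPebbles
section Helpers
variable {Sig : Type} {rank : Sig → ℕ} {k : ℕ}

theorem updVec_inj {α : Type} {n : ℕ} (ν : ℕ → α) {xs : Fin n → ℕ} (a : Fin n → α)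
    (h : Function.Injective xs) (i : Fin n) : updVec ν xs a (xs i) = a i := by
  unfold updVec
  have hex : ∃ j, xs j = xs i := ⟨i, rfl⟩
  rw [dif_pos hex]
  exact congrArg a (h hex.choose_spec)

theorem updVec_of_ne {α : Type} {n : ℕ} (ν : ℕ → α) {xs : Fin n → ℕ} (a : Fin n → α)
    (m : ℕ) (h : ∀ i, xs i ≠ m) : updVec ν xs a m = ν m := by
  unfold updVec
  rw [dif_neg]
  rintro ⟨i, hi⟩
  exact h i hi

/-! ### Definable predicates -/

/-- The predicate `P` on valuations of `V` is definable, whatever variable names are used. -/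
def Def (k : ℕ) (b : Bool) {V : Type} (P : ∀ t : RTree Sig rank, (V → Pos t) → Prop) : Prop :=
  ∀ e : V → ℕ, ∃ φ : TForm Sig rank k, WF φ ∧ PosTC b φ ∧
    ∀ t ν, Sat t φ ν ↔ P t (fun v => ν (e v))

theorem Def.congr {b : Bool} {V : Type} {P Q : ∀ t : RTree Sig rank, (V → Pos t) → Prop}
    (h : Def k b P) (hPQ : ∀ t ρ, P t ρ ↔ Q t ρ) : Def k b Q := by
  intro e
  obtain ⟨φ, h1, h2, h3⟩ := h e
  exact ⟨φ, h1, h2, fun t ν => (h3 t ν).trans (hPQ _ _)⟩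

theorem Def.not {b : Bool} {V : Type} {P : ∀ t : RTree Sig rank, (V → Pos t) → Prop}
    (h : Def k (!b) P) : Def k b (fun t ρ => ¬ P t ρ) := by
  intro e
  obtain ⟨φ, h1, h2, h3⟩ := h e
  exact ⟨.not φ, h1, h2, fun t ν => not_congr (h3 t ν)⟩

theorem Def.and {b : Bool} {V : Type} {P Q : ∀ t : RTree Sig rank, (V → Pos t) → Prop}
    (h : Def k b P) (h' : Def k b Q) : Def k b (fun t ρ => P t ρ ∧ Q t ρ) := by
  intro e
  obtain ⟨φ, h1, h2, h3⟩ := h e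
  obtain ⟨ψ, h1', h2', h3'⟩ := h' e
  exact ⟨.and φ ψ, ⟨h1, h1'⟩, ⟨h2, h2'⟩, fun t ν => and_congr (h3 t ν) (h3' t ν)⟩

theorem Def.or {b : Bool} {V : Type} {P Q : ∀ t : RTree Sig rank, (V → Pos t) → Prop}
    (h : Def k b P) (h' : Def k b Q) : Def k b (fun t ρ => P t ρ ∨ Q t ρ) := by
  intro e
  obtain ⟨φ, h1, h2, h3⟩ := h e
  obtain ⟨ψ, h1', h2', h3'⟩ := h' e
  exact ⟨.or φ ψ, ⟨h1, h1'⟩, ⟨h2, h2'⟩, fun t ν => or_congr (h3 t ν) (h3' t ν)⟩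

theorem Def.const (b : Bool) {V : Type} (c : Prop) :
    Def (Sig := Sig) (rank := rank) k b (V := V) (fun _ _ => c) := by
  intro e
  by_cases hc : c
  · exact ⟨.eq 0 0, trivial, by cases b <;> trivial, fun t ν => by simp [Sat, hc]⟩
  · exact ⟨.not (.eq 0 0), trivial, by cases b <;> trivial, fun t ν => by simp [Sat, hc]⟩

theorem Def.ren {b : Bool} {V W : Type} {P : ∀ t : RTree Sig rank, (V → Pos t) → Prop}
    (h : Def k b P) (f : V → W) : Def k b (fun t (ρ : W → Pos t) => P t (fun v => ρ (f v))) := by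
  intro e
  obtain ⟨φ, h1, h2, h3⟩ := h (fun v => e (f v))
  exact ⟨φ, h1, h2, h3⟩

theorem Def.lab (b : Bool) {V : Type} (a : Sig) (x : V) :
    Def (rank := rank) k b (fun t ρ => labelAt t (ρ x).1 = some a) :=
  fun e => ⟨.lab a (e x), trivial, by cases b <;> trivial, fun _ _ => Iff.rfl⟩

theorem Def.edg (b : Bool) {V : Type} (i : ℕ) (x y : V) :
    Def (Sig := Sig) (rank := rank) k b (fun _ ρ => 1 ≤ i ∧ (ρ y).1 = (ρ x).1 ++ [i - 1]) :=
  fun e => ⟨.edg i (e x) (e y), trivial, by cases b <;> trivial, fun _ _ => Iff.rfl⟩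

theorem Def.eq (b : Bool) {V : Type} (x y : V) :
    Def (Sig := Sig) (rank := rank) k b (fun _ ρ => ρ x = ρ y) :=
  fun e => ⟨.eq (e x) (e y), trivial, by cases b <;> trivial, fun _ _ => Iff.rfl⟩

theorem Def.exFin {b : Bool} {V ι : Type} {P : ι → ∀ t : RTree Sig rank, (V → Pos t) → Prop}
    {S : Set ι} (hS : S.Finite) (h : ∀ i ∈ S, Def k b (P i)) :
    Def k b (fun t ρ => ∃ i ∈ S, P i t ρ) := by
  induction S, hS using Set.Finite.induction_on with
  | empty => exact (Def.const b False).congr (by simp)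
  | @insert a S ha hS ih =>
    exact ((h a (by simp)).or (ih fun i hi => h i (by simp [hi]))).congr (by simp)

theorem Def.allFin {b : Bool} {V ι : Type} {P : ι → ∀ t : RTree Sig rank, (V → Pos t) → Prop}
    {S : Set ι} (hS : S.Finite) (h : ∀ i ∈ S, Def k b (P i)) :
    Def k b (fun t ρ => ∀ i ∈ S, P i t ρ) := by
  induction S, hS using Set.Finite.induction_on with
  | empty => exact (Def.const b True).congr (by simp)
  | @insert a S ha hS ih =>
    exact ((h a (by simp)).and (ih fun i hi => h i (by simp [hi]))).congr (by simp)

/-- Existential quantification of a list of variables. -/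
def exL : List ℕ → TForm Sig rank k → TForm Sig rank k
  | [], φ => φ
  | x :: l, φ => .ex x (exL l φ)

theorem WF_exL (l : List ℕ) (φ : TForm Sig rank k) : WF (exL l φ) ↔ WF φ := by
  induction l with
  | nil => rfl
  | cons x l ih => exact ih

theorem PosTC_exL (b : Bool) (l : List ℕ) (φ : TForm Sig rank k) :
    PosTC b (exL l φ) ↔ PosTC b φ := by
  induction l with
  | nil => rfl
  | cons x l ih => exact ih

theorem freeVars_exL (l : List ℕ) (φ : TForm Sig rank k) :
    freeVars (exL l φ) = freeVars φ \ {x | x ∈ l} := by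
  induction l with
  | nil => simp [exL]
  | cons x l ih =>
    simp only [exL, freeVars, ih]
    ext y
    simp only [Set.mem_sdiff, Set.mem_ofPred_eq, Set.mem_singleton_iff, List.mem_cons]
    tauto

theorem Sat_exL (t : RTree Sig rank) (l : List ℕ) (φ : TForm Sig rank k) (ν : ℕ → Pos t) :
    Sat t (exL l φ) ν ↔ ∃ ν', (∀ n, n ∉ l → ν' n = ν n) ∧ Sat t φ ν' := by
  induction l generalizing ν with
  | nil =>
    simp only [exL]
    constructor
    · intro h
      exact ⟨ν, by simp, h⟩
    · rintro ⟨ν', h, h'⟩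
      have : ν' = ν := funext fun n => h n (by simp)
      exact this ▸ h'
  | cons x l ih =>
    simp only [exL, Sat, ih]
    constructor
    · rintro ⟨u, ν', h, h'⟩
      refine ⟨ν', fun n hn => ?_, h'⟩
      rw [h n (by simp_all), Function.update_of_ne (by simp_all)]
    · rintro ⟨ν', h, h'⟩
      refine ⟨ν' x, ν', fun n hn => ?_, h'⟩
      by_cases hx : n = x
      · subst hx; simp
      · rw [Function.update_of_ne hx, h n (by simp_all)]

theorem freeVars_finite (φ : TForm Sig rank k) : (freeVars φ).Finite := by
  induction φ with
  | tc xs ys φ us vs ih =>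
    simp only [freeVars]
    exact ((ih.subset Set.sdiff_subset).union (Set.finite_range _)).union (Set.finite_range _)
  | and _ _ h1 h2 => exact h1.union h2
  | or _ _ h1 h2 => exact h1.union h2
  | ex _ _ h => exact h.subset Set.sdiff_subset
  | all _ _ h => exact h.subset Set.sdiff_subset
  | not _ h => exact h
  | _ => simp [freeVars]

theorem fresh_vars {V W : Type} [Finite V] [Finite W] (e : V → ℕ) :
    ∃ e' : W → ℕ, Function.Injective e' ∧ ∀ v w, e v ≠ e' w := by
  obtain ⟨M, hM⟩ := (Set.finite_range e).bddAbove
  obtain ⟨n, ⟨f⟩⟩ := Finite.exists_equiv_fin W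
  refine ⟨fun w => M + 1 + (f w : ℕ), fun a b h => ?_, fun v w h => ?_⟩
  · apply f.injective
    apply Fin.ext
    simpa using h
  · have := hM (Set.mem_range_self v)
    simp only at h
    omega

theorem Def.ex {b : Bool} {V W : Type} [Finite V] [Finite W]
    {P : ∀ t : RTree Sig rank, (V ⊕ W → Pos t) → Prop} (h : Def k b P) :
    Def k b (fun t ρ => ∃ a : W → Pos t, P t (Sum.elim ρ a)) := by
  intro e
  obtain ⟨e', he, hd⟩ := fresh_vars (W := W) e
  obtain ⟨φ, h1, h2, h3⟩ := h (Sum.elim e e')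
  obtain ⟨l, hl⟩ : ∃ l : List ℕ, ∀ n, n ∈ l ↔ n ∈ Set.range e' :=
    ⟨(Set.finite_range e').toFinset.toList, by simp⟩
  refine ⟨exL l φ, (WF_exL _ _).2 h1, (PosTC_exL _ _ _).2 h2, fun t ν => ?_⟩
  rw [Sat_exL]
  constructor
  · rintro ⟨ν', h, h'⟩
    rw [h3] at h'
    refine ⟨fun w => ν' (e' w), ?_⟩
    convert h' using 1
    funext v
    rcases v with v | w
    · simp only [Sum.elim_inl]
      rw [h]
      rw [hl]
      rintro ⟨w, hw⟩
      exact hd v w hw.symm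
    · rfl
  · rintro ⟨a, h'⟩
    refine ⟨Function.extend e' a ν, fun n hn => ?_, ?_⟩
    · rw [Function.extend_apply']
      intro h
      exact hn ((hl n).2 h)
    · rw [h3]
      convert h' using 1
      funext v
      rcases v with v | w
      · simp only [Sum.elim_inl]
        rw [Function.extend_apply']
        rintro ⟨w, hw⟩
        exact hd v w hw.symm
      · simp only [Sum.elim_inr]
        rw [he.extend_apply]

/-- A valid formula in which all variables of the list occur. -/
def eqL : List ℕ → TForm Sig rank k
  | [] => .ex 0 (.eq 0 0)
  | x :: l => .and (.eq x x) (eqL l)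

theorem eqL_spec (l : List ℕ) : WF (eqL l : TForm Sig rank k) ∧
    (∀ b, PosTC b (eqL l : TForm Sig rank k)) ∧ (∀ t ν, Sat t (eqL l : TForm Sig rank k) ν) ∧
    ∀ x ∈ l, x ∈ freeVars (eqL l : TForm Sig rank k) := by
  induction l with
  | nil => exact ⟨trivial, fun b => by cases b <;> trivial, fun t ν => ⟨rootPos t, rfl⟩, by simp⟩
  | cons y l ih =>
    refine ⟨⟨trivial, ih.1⟩, fun b => ⟨by cases b <;> trivial, ih.2.1 b⟩,
      fun t ν => ⟨rfl, ih.2.2.1 t ν⟩, fun x hx => ?_⟩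
    rcases List.mem_cons.1 hx with h | h
    · left; simp [freeVars, h]
    · right; exact ih.2.2.2 x h

theorem Def.tc {V : Type} [Finite V]
    {P : ∀ t : RTree Sig rank, (V ⊕ (Fin k ⊕ Fin k) → Pos t) → Prop} (h : Def k true P) :
    Def k true (fun t (ρ : V ⊕ (Fin k ⊕ Fin k) → Pos t) =>
      Relation.ReflTransGen
        (fun a b : Fin k → Pos t => P t (Sum.elim (fun v => ρ (.inl v)) (Sum.elim a b)))
        (fun i => ρ (.inr (.inl i))) (fun i => ρ (.inr (.inr i)))) := by
  intro e
  obtain ⟨e', he, hd⟩ := fresh_vars (W := Fin k ⊕ Fin k) (fun v => e (.inl v))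
  obtain ⟨φ, h1, h2, h3⟩ := h (Sum.elim (fun v => e (.inl v)) e')
  obtain ⟨l, hl⟩ : ∃ l : List ℕ, ∀ n, n ∈ l ↔ n ∈ Set.range e' :=
    ⟨(Set.finite_range e').toFinset.toList, by simp⟩
  obtain ⟨q1, q2, q3, q4⟩ := eqL_spec (rank := rank) (k := k) l
  have i1 : Function.Injective (fun i => e' (.inl i)) := he.comp Sum.inl_injective
  have i2 : Function.Injective (fun i => e' (.inr i)) := he.comp Sum.inr_injective
  have i3 : ∀ i j, e' (.inl i) ≠ e' (.inr j) := fun i j hh => by simpa using he hh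
  refine ⟨.tc (fun i => e' (.inl i)) (fun i => e' (.inr i)) (.and φ (eqL l))
    (fun i => e (.inr (.inl i))) (fun i => e (.inr (.inr i))),
    ⟨⟨i1, i2, i3⟩, ?_, h1, q1⟩, ⟨rfl, h2, q2 _⟩, fun t ν => ?_⟩
  · rintro x (⟨i, rfl⟩ | ⟨i, rfl⟩)
    · exact Or.inr (q4 _ ((hl _).2 ⟨_, rfl⟩))
    · exact Or.inr (q4 _ ((hl _).2 ⟨_, rfl⟩))
  · simp only [Sat]
    have : (fun a b : Fin k → Pos t => Sat t φ (updVec (updVec ν (fun i => e' (.inl i)) a)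
          (fun i => e' (.inr i)) b) ∧ Sat t (eqL l : TForm Sig rank k)
            (updVec (updVec ν (fun i => e' (.inl i)) a) (fun i => e' (.inr i)) b)) =
        (fun a b : Fin k → Pos t =>
          P t (Sum.elim (fun v => ν (e (.inl v))) (Sum.elim a b))) := by
      funext a b
      rw [eq_true (q3 t _), and_true, h3]
      congr 1
      funext v
      rcases v with v | i | i
      · simp only [Sum.elim_inl]
        rw [updVec_of_ne _ _ _ fun i => (hd v _).symm, updVec_of_ne _ _ _ fun i => (hd v _).symm]
      · simp only [Sum.elim_inl, Sum.elim_inr]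
        rw [updVec_of_ne _ _ _ fun j => (i3 i j).symm, updVec_inj _ _ i1]
      · simp only [Sum.elim_inr]
        rw [updVec_inj _ _ i2]
    rw [this]

theorem Def.closed {P : RTree Sig rank → Prop}
    (h : Def k true (V := Empty) (fun t _ => P t)) : {t | P t} ∈ FOposTC Sig rank k := by
  obtain ⟨φ, h1, h2, h3⟩ := h Empty.elim
  obtain ⟨l, hl⟩ : ∃ l : List ℕ, ∀ n, n ∈ l ↔ n ∈ freeVars φ :=
    ⟨(freeVars_finite φ).toFinset.toList, by simp⟩
  refine ⟨exL l φ, (WF_exL _ _).2 h1, (PosTC_exL _ _ _).2 h2, ?_, ?_⟩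
  · rw [freeVars_exL]
    ext n
    simp [hl]
  · ext t
    simp only [treesOf, Set.mem_ofPred_eq, Sat_exL, h3]
    exact ⟨fun h => ⟨_, fun _ _ => rfl, h⟩, fun ⟨_, _, h⟩ => h⟩

/-! ### Kleene's state elimination -/

/-- Nonempty paths all of whose intermediate states are in `S`. -/
inductive Via {Q A : Type} (T : Q × A → Q × A → Prop) (S : Set Q) : Q × A → Q × A → Prop
  | base {x y} : T x y → Via T S x y
  | step {x y z} : Via T S x y → y.1 ∈ S → T y z → Via T S x z

theorem Via.trans {Q A : Type} {T : Q × A → Q × A → Prop} {S : Set Q} {x y z : Q × A}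
    (h : Via T S x y) (hy : y.1 ∈ S) (h' : Via T S y z) : Via T S x z := by
  induction h' with
  | base h' => exact h.step hy h'
  | step _ h1 h2 ih => exact ih.step h1 h2

theorem Via.mono {Q A : Type} {T : Q × A → Q × A → Prop} {S S' : Set Q} (hS : S ⊆ S')
    {x y : Q × A} (h : Via T S x y) : Via T S' x y := by
  induction h with
  | base h => exact .base h
  | step _ h1 h2 ih => exact ih.step (hS h1) h2

theorem via_insert {Q A : Type} {T : Q × A → Q × A → Prop} {S : Set Q} {r : Q} {x y : Q × A} :
    Via T (insert r S) x y ↔ Via T S x y ∨ ∃ c d, Via T S x (r, c) ∧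
      Relation.ReflTransGen (fun c d => Via T S (r, c) (r, d)) c d ∧ Via T S (r, d) y := by
  constructor
  · intro h
    induction h with
    | base h => exact Or.inl (.base h)
    | @step y z h1 h2 h3 ih =>
      by_cases hy : y.1 ∈ S
      · rcases ih with ih | ⟨c, d, i1, i2, i3⟩
        · exact Or.inl (ih.step hy h3)
        · exact Or.inr ⟨c, d, i1, i2, i3.step hy h3⟩
      · obtain ⟨y1, y2⟩ := y
        obtain rfl : y1 = r := by
          rcases h2 with h2 | h2
          · exact h2
          · exact absurd h2 hy
        rcases ih with ih | ⟨c, d, i1, i2, i3⟩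
        · exact Or.inr ⟨y2, y2, ih, .refl, .base h3⟩
        · exact Or.inr ⟨c, y2, i1, i2.tail i3, .base h3⟩
  · rintro (h | ⟨c, d, h1, h2, h3⟩)
    · exact h.mono (Set.subset_insert _ _)
    · have key : ∀ d, Relation.ReflTransGen (fun c d => Via T S (r, c) (r, d)) c d →
          Via T (insert r S) x (r, d) := by
        intro d h
        induction h with
        | refl => exact h1.mono (Set.subset_insert _ _)
        | tail _ h ih => exact ih.trans (by simp) (h.mono (Set.subset_insert _ _))
      exact (key d h2).trans (by simp) (h3.mono (Set.subset_insert _ _))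

theorem star_iff_via {Q A : Type} {T : Q × A → Q × A → Prop} {x y : Q × A} :
    Relation.ReflTransGen T x y ↔ x = y ∨ Via T Set.univ x y := by
  constructor
  · intro h
    induction h with
    | refl => exact Or.inl rfl
    | tail _ h ih =>
      rcases ih with rfl | ih
      · exact Or.inr (.base h)
      · exact Or.inr (ih.step trivial h)
  · rintro (rfl | h)
    · exact .refl
    · induction h with
      | base h => exact .single h
      | step _ _ h ih => exact ih.tail h

/-- Definable relations between tuples of head positions, with parameters. -/
def DefRel (k : ℕ) {V : Type}
    (R : ∀ t : RTree Sig rank, (V → Pos t) → (Fin k → Pos t) → (Fin k → Pos t) → Prop) : Prop :=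
  Def k true (fun t (ρ : V ⊕ (Fin k ⊕ Fin k) → Pos t) =>
    R t (fun v => ρ (.inl v)) (fun i => ρ (.inr (.inl i))) (fun i => ρ (.inr (.inr i))))

theorem DefRel.star {V : Type} [Finite V]
    {R : ∀ t : RTree Sig rank, (V → Pos t) → (Fin k → Pos t) → (Fin k → Pos t) → Prop}
    (h : DefRel k R) : DefRel k (fun t ρ => Relation.ReflTransGen (R t ρ)) :=
  (Def.tc h).congr (fun _ _ => Iff.rfl)

theorem DefRel.comp {V : Type} [Finite V]
    {R S : ∀ t : RTree Sig rank, (V → Pos t) → (Fin k → Pos t) → (Fin k → Pos t) → Prop}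
    (h : DefRel k R) (h' : DefRel k S) :
    DefRel k (fun t ρ a b => ∃ c, R t ρ a c ∧ S t ρ c b) := by
  have h1 := Def.ren h (W := (V ⊕ (Fin k ⊕ Fin k)) ⊕ Fin k)
    (Sum.elim (fun v => .inl (.inl v)) (Sum.elim (fun i => .inl (.inr (.inl i))) .inr))
  have h2 := Def.ren h' (W := (V ⊕ (Fin k ⊕ Fin k)) ⊕ Fin k)
    (Sum.elim (fun v => .inl (.inl v)) (Sum.elim .inr (fun i => .inl (.inr (.inr i)))))
  exact (h1.and h2).ex.congr (fun _ _ => Iff.rfl)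

theorem DefRel.via {V Q : Type} [Finite V]
    {T : ∀ t : RTree Sig rank, (V → Pos t) → Q × (Fin k → Pos t) → Q × (Fin k → Pos t) → Prop}
    (h : ∀ p q, DefRel k (fun t ρ a b => T t ρ (p, a) (q, b))) {S : Set Q} (hS : S.Finite) :
    ∀ p q, DefRel k (fun t ρ a b => Via (T t ρ) S (p, a) (q, b)) := by
  induction S, hS using Set.Finite.induction_on with
  | empty =>
    intro p q
    refine (h p q).congr fun t ρ => ⟨.base, fun h => ?_⟩
    cases h with
    | base h => exact h
    | step _ h _ => exact h.elim
  | @insert r S hr hS ih =>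
    intro p q
    refine ((ih p q).or ((ih p r).comp ((ih r r).star.comp (ih r q)))).congr fun t ρ => ?_
    dsimp only
    rw [via_insert]
    simp only [exists_and_left]

theorem Def.eqTuple (b : Bool) {V : Type} (f g : Fin k → V) :
    Def (Sig := Sig) (rank := rank) k b (fun _ ρ => (fun i => ρ (f i)) = (fun i => ρ (g i))) :=
  (Def.allFin (Set.finite_univ) fun i _ => Def.eq b (f i) (g i)).congr
    (by simp [funext_iff])

theorem DefRel.starQ {V Q : Type} [Finite V] [Finite Q]
    {T : ∀ t : RTree Sig rank, (V → Pos t) → Q × (Fin k → Pos t) → Q × (Fin k → Pos t) → Prop}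
    (h : ∀ p q, DefRel k (fun t ρ a b => T t ρ (p, a) (q, b))) (p q : Q) :
    DefRel k (fun t ρ a b => Relation.ReflTransGen (T t ρ) (p, a) (q, b)) := by
  refine ((((Def.const true (p = q)).and (Def.eqTuple true
    (fun i => .inr (.inl i)) (fun i => .inr (.inr i)))).or
    (DefRel.via h Set.finite_univ p q))).congr fun t ρ => ?_
  dsimp only
  rw [star_iff_via]
  simp

end Helpers
end NestedPebbles

namespace NestedPebbles
section Positions
variable {Sig : Type} {rank : Sig → ℕ} {k : ℕ}

theorem subtree_append (t : RTree Sig rank) (p q : List ℕ) :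
    t.subtree (p ++ q) = (t.subtree p).bind fun s => s.subtree q := by
  induction p generalizing t with
  | nil => simp [RTree.subtree]
  | cons i p ih =>
    simp only [List.cons_append, RTree.subtree]
    cases t.child i with
    | none => rfl
    | some s => simp [ih]

theorem isPos_snoc (t : RTree Sig rank) (w : List ℕ) (j : ℕ) :
    IsPos t (w ++ [j]) ↔ ∃ a, labelAt t w = some a ∧ j < rank a := by
  unfold IsPos labelAt
  rw [subtree_append]
  cases t.subtree w with
  | none => simp
  | some s =>
    obtain ⟨a, c⟩ := s
    by_cases h : j < rank a <;> simp [RTree.subtree, RTree.child, RTree.label, h]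

theorem isPos_of_append {t : RTree Sig rank} {p q : List ℕ} (h : IsPos t (p ++ q)) :
    IsPos t p := by
  unfold IsPos at *
  rw [subtree_append] at h
  cases h' : t.subtree p with
  | none => simp [h'] at h
  | some s => rfl

theorem labelAt_of_isPos {t : RTree Sig rank} {p : List ℕ} (h : IsPos t p) :
    ∃ a, labelAt t p = some a := by
  unfold IsPos at h
  unfold labelAt
  obtain ⟨s, hs⟩ := Option.isSome_iff_exists.1 h
  exact ⟨s.label, by simp [hs]⟩

theorem exists_maxRank [Fintype Sig] (rank : Sig → ℕ) : ∃ M, ∀ a, rank a ≤ M := by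
  obtain ⟨M, hM⟩ := (Set.finite_range rank).bddAbove
  exact ⟨M, fun a => hM ⟨a, rfl⟩⟩

@[simp] theorem childNo_nil : childNo [] = 0 := rfl

@[simp] theorem childNo_snoc (w : List ℕ) (j : ℕ) : childNo (w ++ [j]) = j + 1 := by
  simp [childNo]

theorem childNo_zero {p : List ℕ} : childNo p = 0 ↔ p = [] := by
  rcases List.eq_nil_or_concat p with rfl | ⟨w, j, rfl⟩
  · simp
  · simp

theorem childNo_succ {p : List ℕ} {j : ℕ} : childNo p = j + 1 ↔ ∃ w, p = w ++ [j] := by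
  rcases List.eq_nil_or_concat p with rfl | ⟨w, i, rfl⟩
  · simp
  · simp only [List.concat_eq_append, childNo_snoc, Nat.add_right_cancel_iff]
    constructor
    · rintro rfl; exact ⟨w, rfl⟩
    · rintro ⟨w', h⟩
      simpa using congrArg List.getLast? h

/-- Build a node from a valid position. -/
def mkPos {t : RTree Sig rank} (p : List ℕ) (h : IsPos t p) : Pos t := ⟨p, h⟩

theorem pos_ext {t : RTree Sig rank} {u v : Pos t} (h : u.1 = v.1) : u = v := Subtype.ext h

theorem Def.chno [Fintype Sig] (b : Bool) {V : Type} [Finite V] (x : V) (j : ℕ) :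
    Def (Sig := Sig) (rank := rank) k b (fun _ ρ => childNo (ρ x).1 = j) := by
  obtain ⟨M, hM⟩ := exists_maxRank rank
  have key : ∀ b j, Def (Sig := Sig) (rank := rank) k b
      (fun _ ρ => childNo (ρ x).1 = j + 1) := by
    intro b j
    refine (Def.ex (W := Unit) (Def.edg b (j + 1) (.inr ()) (.inl x))).congr fun t ρ => ?_
    simp only [Sum.elim_inl, Sum.elim_inr, childNo_succ]
    constructor
    · rintro ⟨a, -, h⟩
      exact ⟨_, h⟩
    · rintro ⟨w, h⟩
      have hw : IsPos t w := isPos_of_append (q := [j]) (h ▸ (ρ x).2)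
      exact ⟨fun _ => ⟨w, hw⟩, by omega, h⟩
  cases j with
  | succ j => exact key b j
  | zero =>
    have h1 : Def (Sig := Sig) (rank := rank) k (!b) (V := V)
        (fun t ρ => ∃ j ∈ Set.Iio M, childNo (ρ x).1 = j + 1) :=
      Def.exFin (Set.finite_Iio M) fun j _ => key _ j
    refine (Def.not h1).congr fun t ρ => ?_
    simp only [childNo_succ, childNo_zero]
    constructor
    · intro h
      rcases List.eq_nil_or_concat (ρ x).1 with h' | ⟨w, j, h'⟩
      · exact h'
      · rw [List.concat_eq_append] at h'
        refine absurd ⟨j, ?_, w, h'⟩ h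
        have := (ρ x).2
        rw [h', isPos_snoc] at this
        obtain ⟨a, -, ha⟩ := this
        exact lt_of_lt_of_le ha (hM a)
    · rintro h ⟨j, -, w, h'⟩
      simp [h] at h'

end Positions

section Aut
variable {Sig : Type} {rank : Sig → ℕ} {k : ℕ}

/-- Instructions that do not change the pebble stack. -/
def IsBasic {X : Type} : TInstr Sig k X → Prop
  | .dropPeb _ _ => False
  | .retrieve _ => False
  | _ => True

/-- Computations that start and end with pebble stack `π` and never go below it. -/
inductive Run (A : TWA Sig rank k) (t : RTree Sig rank) : List (A.X × Pos t) →
    A.Q × (Fin k → Pos t) → A.Q × (Fin k → Pos t) → Prop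
  | refl (π c) : Run A t π c c
  | basic {π c c' c''} (ins) : Run A t π c c' → (c'.1, ins, c''.1) ∈ A.instr → IsBasic ins →
      instrStep t ins c'.2 π c''.2 π → Run A t π c c''
  | nest {π c c' c''} (i x p' q') : Run A t π c c' → (c'.1, .dropPeb i x, p') ∈ A.instr →
      (∀ w, (x, w) ∉ π) → (q', .retrieve x, c''.1) ∈ A.instr →
      Run A t ((x, c'.2 i) :: π) (p', c'.2) (q', c''.2) → Run A t π c c''

def Tr (A : TWA Sig rank k) (t : RTree Sig rank) (π : List (A.X × Pos t))
    (c c' : A.Q × (Fin k → Pos t)) : Prop :=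
  (∃ ins ∈ {ins | (c.1, ins, c'.1) ∈ A.instr ∧ IsBasic ins}, instrStep t ins c.2 π c'.2 π) ∨
  ∃ y ∈ (Set.univ : Set (Fin k × A.X × A.Q × A.Q)),
    ((c.1, .dropPeb y.1 y.2.1, y.2.2.1) ∈ A.instr ∧
    (∀ w, (y.2.1, w) ∉ π) ∧ (y.2.2.2, .retrieve y.2.1, c'.1) ∈ A.instr) ∧
      Run A t ((y.2.1, c.2 y.1) :: π) (y.2.2.1, c.2) (y.2.2.2, c'.2)

theorem run_iff (A : TWA Sig rank k) (t : RTree Sig rank) (π : List (A.X × Pos t))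
    (c c' : A.Q × (Fin k → Pos t)) :
    Run A t π c c' ↔ Relation.ReflTransGen (Tr A t π) c c' := by
  constructor
  · intro h
    induction h with
    | refl => exact .refl
    | basic ins _ h1 h2 h3 ih => exact ih.tail (Or.inl ⟨ins, ⟨h1, h2⟩, h3⟩)
    | nest i x p' q' _ h1 h2 h3 h4 ih _ =>
      exact ih.tail (Or.inr ⟨(i, x, p', q'), trivial, ⟨h1, h2, h3⟩, h4⟩)
  · intro h
    induction h with
    | refl => exact .refl _ _
    | tail _ h ih =>
      rcases h with ⟨ins, ⟨h1, h2⟩, h3⟩ | ⟨⟨i, x, p', q'⟩, -, ⟨h1, h2, h3⟩, h4⟩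
      · exact .basic ins ih h1 h2 h3
      · exact .nest i x p' q' ih h1 h2 h3 h4

theorem Run.steps {A : TWA Sig rank k} {t : RTree Sig rank} {π : List (A.X × Pos t)}
    {c c' : A.Q × (Fin k → Pos t)} (h : Run A t π c c') :
    Relation.ReflTransGen (Step A t) (c.1, c.2, π) (c'.1, c'.2, π) := by
  induction h with
  | refl => exact .refl
  | basic ins _ h1 h2 h3 ih => exact ih.tail ⟨ins, h1, h3⟩
  | @nest π c c' c'' i x p' q' _ h1 h2 h3 h4 ih ih' =>
    have s1 : Step A t (c'.1, c'.2, π) (p', c'.2, (x, c'.2 i) :: π) :=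
      ⟨.dropPeb i x, h1, rfl, rfl, h2⟩
    have s2 : Step A t (q', c''.2, (x, c'.2 i) :: π) (c''.1, c''.2, π) :=
      ⟨.retrieve x, h3, rfl, _, rfl⟩
    exact ((ih.tail s1).trans ih').tail s2

/-- Decomposition of a computation along the pebble stack. -/
def Inv (A : TWA Sig rank k) (t : RTree Sig rank) (c0 : A.Q × (Fin k → Pos t)) :
    List (A.X × Pos t) → A.Q × (Fin k → Pos t) → Prop
  | [], c => Run A t [] c0 c
  | (x, u) :: π, c => ∃ c1 i p', Inv A t c0 π c1 ∧ (c1.1, .dropPeb i x, p') ∈ A.instr ∧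
      c1.2 i = u ∧ (∀ w, (x, w) ∉ π) ∧ Run A t ((x, u) :: π) (p', c1.2) c

theorem Inv.extend {A : TWA Sig rank k} {t : RTree Sig rank} {c0 : A.Q × (Fin k → Pos t)}
    {π : List (A.X × Pos t)} {c c' : A.Q × (Fin k → Pos t)} (h : Inv A t c0 π c)
    (hr : ∀ d, Run A t π d c → Run A t π d c') : Inv A t c0 π c' := by
  rcases π with _ | ⟨⟨x, u⟩, π⟩
  · exact hr _ h
  · obtain ⟨c1, i, p', h1, h2, h3, h4, h5⟩ := h
    exact ⟨c1, i, p', h1, h2, h3, h4, hr _ h5⟩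

theorem inv_of_steps {A : TWA Sig rank k} {t : RTree Sig rank} {c0 : A.Q × (Fin k → Pos t)}
    {d : TConf A t} (h : Relation.ReflTransGen (Step A t) (c0.1, c0.2, []) d) :
    Inv A t c0 d.2.2 (d.1, d.2.1) := by
  induction h with
  | refl => exact Run.refl _ _
  | @tail d d' _ hs ih =>
    obtain ⟨p, a, π⟩ := d
    obtain ⟨q, b, π'⟩ := d'
    obtain ⟨ins, hi, hs⟩ := hs
    simp only at *
    have basic : π' = π → IsBasic ins → Inv A t c0 π' (q, b) := by
      rintro rfl hb
      exact ih.extend fun d hd => .basic ins hd hi hb hs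
    cases ins with
    | up i => exact basic hs.1 trivial
    | down i j => exact basic hs.1 trivial
    | test b τ => exact basic hs.2.1 trivial
    | dropPeb i x =>
      obtain ⟨rfl, rfl, h⟩ := hs
      exact ⟨(p, b), i, q, ih, hi, rfl, h, .refl _ _⟩
    | retrieve x =>
      obtain ⟨rfl, w, rfl⟩ := hs
      obtain ⟨c1, i, p', h1, h2, rfl, h4, h5⟩ := ih
      exact h1.extend fun d hd => .nest i x p' p hd h2 h4 hi h5

theorem instr_def [Fintype Sig] {X : Type} [Finite X] (s : List X) (ins : TInstr Sig k X)
    (hb : IsBasic ins) :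
    DefRel (Sig := Sig) (rank := rank) k (V := X) (fun t ρ a b =>
      instrStep t ins a (s.map fun x => (x, ρ x)) b (s.map fun x => (x, ρ x))) := by
  obtain ⟨M, hM⟩ := exists_maxRank rank
  have frame : ∀ i, DefRel (Sig := Sig) (rank := rank) k (V := X) (fun t ρ a b =>
      ∀ h, h ≠ i → b h = a h) := by
    intro i
    exact (Def.allFin (S := {h | h ≠ i}) (Set.toFinite _) fun h _ =>
      Def.eq true (V := X ⊕ (Fin k ⊕ Fin k)) (.inr (.inr h)) (.inr (.inl h))).congr fun t ρ => Iff.rfl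
  cases ins with
  | dropPeb i x => exact hb.elim
  | retrieve x => exact hb.elim
  | up i =>
    have h1 : DefRel (Sig := Sig) (rank := rank) k (V := X) (fun t ρ a b =>
        ∃ j ∈ Set.Iio M, 1 ≤ j + 1 ∧ (a i).1 = (b i).1 ++ [j + 1 - 1]) :=
      Def.exFin (Set.finite_Iio M) fun j _ =>
        Def.edg true (V := X ⊕ (Fin k ⊕ Fin k)) (j + 1) (.inr (.inr i)) (.inr (.inl i))
    refine (h1.and (frame i)).congr fun t ρ => ?_
    simp only [instrStep, true_and]
    refine and_congr_left fun _ => ?_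
    constructor
    · rintro ⟨j, -, -, h⟩
      exact ⟨j, h⟩
    · rintro ⟨j, h⟩
      refine ⟨j, ?_, by omega, h⟩
      have := (ρ (.inr (.inl i))).2
      rw [h, isPos_snoc] at this
      obtain ⟨a, -, ha⟩ := this
      exact lt_of_lt_of_le ha (hM a)
  | down i j =>
    refine ((Def.edg true (V := X ⊕ (Fin k ⊕ Fin k)) j (.inr (.inl i)) (.inr (.inr i))).and (frame i)).congr fun t ρ => ?_
    simp only [instrStep, true_and, and_assoc]
  | test c τ =>
    have hτ : ∀ b, Def (Sig := Sig) (rank := rank) k b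
        (fun t (ρ : X ⊕ (Fin k ⊕ Fin k) → Pos t) =>
          testHolds t τ (fun i => ρ (.inr (.inl i))) (s.map fun x => (x, ρ (.inl x)))) := by
      intro b
      cases τ with
      | lab i a => exact Def.lab b a _
      | chno i j => exact Def.chno b _ j
      | peb i x =>
        refine ((Def.const b (x ∈ s)).and (Def.eq b (.inl x) (.inr (.inl i)))).congr
          fun t ρ => ?_
        simp [testHolds]
    have hc : Def (Sig := Sig) (rank := rank) k true
        (fun t (ρ : X ⊕ (Fin k ⊕ Fin k) → Pos t) =>
          (testHolds t τ (fun i => ρ (.inr (.inl i))) (s.map fun x => (x, ρ (.inl x))) ↔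
            c = true)) := by
      cases c
      · exact (Def.not (hτ _)).congr (by simp)
      · exact (hτ _).congr (by simp)
    refine ((Def.eqTuple true (fun i => .inr (.inr i)) (fun i => .inr (.inl i))).and hc).congr
      fun t ρ => ?_
    simp only [instrStep, true_and]

theorem run_def [Fintype Sig] (A : TWA Sig rank k) (n : ℕ) : ∀ s : List A.X,
    {x | x ∉ s}.ncard ≤ n → ∀ p q, DefRel (Sig := Sig) (rank := rank) k (V := A.X)
      (fun t ρ a b => Run A t (s.map fun x => (x, ρ x)) (p, a) (q, b)) := by
  have := A.finQ
  have := A.finX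
  classical
  induction n using Nat.strong_induction_on with
  | _ n ih =>
    intro s hs p q
    simp only [run_iff]
    refine DefRel.starQ (T := fun t ρ => Tr A t (s.map fun x => (x, ρ x))) (fun p q => ?_) p q
    refine Def.or (Def.exFin (S := {ins | (p, ins, q) ∈ A.instr ∧ IsBasic ins}) ?_
      fun ins hins => instr_def s ins hins.2)
      (Def.exFin Set.finite_univ fun y _ => ?_)
    · refine Set.Finite.subset (A.instrFin.image fun z => z.2.1) ?_
      rintro ins ⟨h, -⟩
      exact ⟨_, h, rfl⟩
    · obtain ⟨i, x, p', q'⟩ := y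
      simp only
      by_cases hx : x ∈ s
      · refine (Def.const true False).congr fun t ρ => ?_
        simp only [false_iff]
        rintro ⟨⟨-, h, -⟩, -⟩
        exact h (ρ (.inl x)) (List.mem_map.2 ⟨x, hx, rfl⟩)
      · have hlt : {y | y ∉ x :: s}.ncard < {y | y ∉ s}.ncard := by
          apply Set.ncard_lt_ncard _ (Set.toFinite _)
          refine ⟨fun y hy => ?_, fun h => ?_⟩
          · simp only [Set.mem_ofPred_eq, List.mem_cons, not_or] at hy ⊢
            exact hy.2
          · exact h (show x ∈ {y | y ∉ s} from hx) (by simp)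
        have h1 := ih _ (lt_of_lt_of_le hlt hs) (x :: s) le_rfl p' q'
        have h2 := Def.ren h1 (W := A.X ⊕ (Fin k ⊕ Fin k)) (fun v =>
          if v = .inl x then .inr (.inl i) else v)
        refine ((Def.const true ((p, TInstr.dropPeb i x, p') ∈ A.instr ∧
          (q', TInstr.retrieve x, q) ∈ A.instr)).and h2).congr fun t ρ => ?_
        have e1 : (∀ w, (x, w) ∉ s.map fun x => (x, ρ (.inl x))) := by
          intro w hw
          obtain ⟨y, hy, h⟩ := List.mem_map.1 hw
          simp only [Prod.mk.injEq] at h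
          exact hx (h.1 ▸ hy)
        have e2 : (s.map fun y => (y, ρ (if (Sum.inl y : A.X ⊕ (Fin k ⊕ Fin k)) = .inl x
            then .inr (.inl i) else .inl y))) = s.map fun y => (y, ρ (.inl y)) := by
          apply List.map_congr_left
          intro y hy
          rw [if_neg]
          intro h
          exact hx (Sum.inl_injective h ▸ hy)
        simp only [List.map_cons, e2, if_true, reduceCtorEq, if_false]
        tauto

theorem labelAt_nil (t : RTree Sig rank) : labelAt t [] = some t.label := rfl

theorem halting_congr (A : TWA Sig rank k) {t t' : RTree Sig rank} (hl : t.label = t'.label)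
    (q : A.Q) (h : HaltingConf A t (q, fun _ => rootPos t, [])) :
    HaltingConf A t' (q, fun _ => rootPos t', []) := by
  rintro ⟨q', hs', π'⟩ ⟨ins, hi, hstep⟩
  have hl' : labelAt t [] = labelAt t' [] := by rw [labelAt_nil, labelAt_nil, hl]
  cases ins with
  | up i =>
    obtain ⟨-, ⟨j, hj⟩, -⟩ := hstep
    simp [rootPos] at hj
  | down i j =>
    obtain ⟨-, h1, h2, -⟩ := hstep
    have hp := (hs' i).2
    rw [h2] at hp
    have hp' : IsPos t ([] ++ [j - 1]) := by
      rw [isPos_snoc, hl', ← isPos_snoc]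
      exact hp
    have e1 : ((Function.update (fun _ => rootPos t) i (mkPos _ hp') : Fin k → Pos t) i).1 =
        [] ++ [j - 1] := by
      rw [Function.update_self]
      rfl
    exact h (q', Function.update (fun _ => rootPos t) i (mkPos _ hp'), [])
      ⟨.down i j, hi, rfl, h1, e1,
        fun h hh => Function.update_of_ne hh (mkPos _ hp') (fun _ => rootPos t)⟩
  | dropPeb i x =>
    exact h (q', fun _ => rootPos t, [(x, rootPos t)]) ⟨.dropPeb i x, hi, rfl, rfl, by simp⟩
  | retrieve x =>
    obtain ⟨-, w, hw⟩ := hstep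
    simp at hw
  | test b τ =>
    refine h (q', fun _ => rootPos t, []) ⟨.test b τ, hi, rfl, rfl, ?_⟩
    rw [← hstep.2.2]
    cases τ with
    | lab i a => simp only [testHolds, rootPos, hl']
    | peb i x => simp [testHolds]
    | chno i j => simp [testHolds, rootPos]

theorem accepts_def [Fintype Sig] (hk : 1 ≤ k) (A : TWA Sig rank k) :
    Lang A ∈ FOposTC Sig rank k := by
  have := A.finQ
  have := A.finX
  apply Def.closed
  have hroot : ∀ i, Def (Sig := Sig) (rank := rank) k true
      (V := Empty ⊕ (A.X ⊕ (Fin k ⊕ Fin k))) (fun t ρ => childNo (ρ (.inr (.inr i))).1 = 0) :=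
    fun i => Def.chno true _ 0
  have h1 : ∀ q, Def (Sig := Sig) (rank := rank) k true (V := Empty) (fun t ρ =>
      ∃ z : A.X ⊕ (Fin k ⊕ Fin k) → Pos t,
        (∀ i ∈ Set.univ, childNo (z (.inr i)).1 = 0) ∧
        (∃ a ∈ Set.univ, labelAt t (z (.inr (.inl ⟨0, hk⟩))).1 = some a ∧
          ∃ t' : RTree Sig rank, t'.label = a ∧
            HaltingConf A t' (q, fun _ => rootPos t', [])) ∧
        Run A t ([].map fun x => (x, z (.inl x))) (A.q0, fun i => z (.inr (.inl i)))
          (q, fun i => z (.inr (.inr i)))) := by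
    intro q
    refine (Def.ex ((Def.allFin Set.finite_univ fun i _ => hroot i).and
      ((Def.exFin Set.finite_univ fun a _ => ((Def.lab true a (V := Empty ⊕ (A.X ⊕ (Fin k ⊕ Fin k))) (.inr (.inr (.inl ⟨0, hk⟩)))).and
        (Def.const true (∃ t' : RTree Sig rank, t'.label = a ∧
            HaltingConf A t' (q, fun _ => rootPos t', []))))).and
        (Def.ren (run_def A _ [] le_rfl A.q0 q) .inr)))).congr fun t ρ => Iff.rfl
  refine (Def.exFin (Set.toFinite A.acc) fun q _ => h1 q).congr fun t _ => ?_
  unfold Accepts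
  refine exists_congr fun q => and_congr_right fun _ => ?_
  constructor
  · rintro ⟨z, hz, ⟨a, -, ha, t', ht', hh⟩, hr⟩
    have hz' : ∀ i, z (.inr i) = rootPos t := fun i => pos_ext (childNo_zero.1 (hz i trivial))
    simp only [hz', List.map_nil] at hr ha
    refine ⟨hr.steps, halting_congr A ?_ q hh⟩
    rw [ht']
    have h2 : labelAt t [] = some a := ha
    rw [labelAt_nil] at h2
    exact (Option.some.inj h2).symm
  · rintro ⟨hr, hh⟩
    refine ⟨fun _ => rootPos t, fun _ _ => rfl, ⟨t.label, trivial, rfl, t, rfl, hh⟩, ?_⟩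
    exact inv_of_steps (c0 := (A.q0, fun _ => rootPos t)) hr

end Aut
end NestedPebbles

namespace NestedPebbles
section Programs
variable {Sig : Type} {rank : Sig → ℕ} {k : ℕ}

/-- Regular programs over automaton instructions. -/
inductive Prog (Sig : Type) (k : ℕ) (X : Type) : Type
  | ins (i : TInstr Sig k X)
  | skip
  | fail
  | seq (p q : Prog Sig k X)
  | alt (p q : Prog Sig k X)
  | star (p : Prog Sig k X)

/-- Relational semantics of programs. -/
def sem {X : Type} (t : RTree Sig rank) : Prog Sig k X →
    (Fin k → Pos t) × List (X × Pos t) → (Fin k → Pos t) × List (X × Pos t) → Prop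
  | .ins i, s, s' => instrStep t i s.1 s.2 s'.1 s'.2
  | .skip, s, s' => s = s'
  | .fail, _, _ => False
  | .seq p q, s, s' => ∃ m, sem t p s m ∧ sem t q m s'
  | .alt p q, s, s' => sem t p s s' ∨ sem t q s s'
  | .star p, s, s' => Relation.ReflTransGen (sem t p) s s'

inductive PStep {X : Type} :
    List (Prog Sig k X) → Option (TInstr Sig k X) → List (Prog Sig k X) → Prop
  | ins (i K) : PStep (.ins i :: K) (some i) K
  | skip (K) : PStep (.skip :: K) none K
  | seq (p q K) : PStep (.seq p q :: K) none (p :: q :: K)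
  | altl (p q K) : PStep (.alt p q :: K) none (p :: K)
  | altr (p q K) : PStep (.alt p q :: K) none (q :: K)
  | star0 (p K) : PStep (.star p :: K) none K
  | star1 (p K) : PStep (.star p :: K) none (p :: .star p :: K)

/-- The continuation stacks that can occur when running `p` with continuation `K`. -/
def reach {X : Type} : Prog Sig k X → List (Prog Sig k X) → Set (List (Prog Sig k X))
  | .seq p q, K => {.seq p q :: K} ∪ (reach p (q :: K) ∪ reach q K)
  | .alt p q, K => {.alt p q :: K} ∪ (reach p K ∪ reach q K)
  | .star p, K => {.star p :: K, K} ∪ reach p (.star p :: K)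
  | p, K => {p :: K, K}

theorem reach_finite {X : Type} (p : Prog Sig k X) (K : List (Prog Sig k X)) :
    (reach p K).Finite := by
  induction p generalizing K with
  | seq p q ih1 ih2 => exact (Set.finite_singleton _).union ((ih1 _).union (ih2 _))
  | alt p q ih1 ih2 => exact (Set.finite_singleton _).union ((ih1 _).union (ih2 _))
  | star p ih => exact (Set.toFinite _).union (ih _)
  | _ => simp [reach]

theorem self_mem_reach {X : Type} (p : Prog Sig k X) (K : List (Prog Sig k X)) :
    p :: K ∈ reach p K := by
  cases p <;> simp [reach]

theorem tail_mem_reach {X : Type} (p : Prog Sig k X) (K : List (Prog Sig k X)) :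
    K ∈ reach p K := by
  induction p generalizing K with
  | seq p q ih1 ih2 => exact Or.inr (Or.inr (ih2 _))
  | alt p q ih1 ih2 => exact Or.inr (Or.inr (ih2 _))
  | star p ih => simp [reach]
  | _ => simp [reach]

/-- The automaton of a program. -/
noncomputable def progAut {X : Type} [Fintype X] (rank : Sig → ℕ) (z : Fin k) (P : Prog Sig k X) :
    TWA Sig rank k where
  Q := reach P []
  finQ := (reach_finite P []).fintype
  X := X
  finX := inferInstance
  q0 := ⟨[P], self_mem_reach P []⟩
  acc := {q | q.1 = []}
  instr := {y | PStep y.1.1 (some y.2.1) y.2.2.1 ∨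
    (PStep y.1.1 none y.2.2.1 ∧ ∃ b, y.2.1 = .test b (.chno z 0))}
  instrFin := by
    have := (reach_finite P []).to_subtype
    have hF : ∀ q : reach P [], ({i | ∃ K, q.1 = .ins i :: K} ∪
        {.test true (.chno z 0), .test false (.chno z 0)} : Set (TInstr Sig k X)).Finite := by
      intro q
      refine Set.Finite.union (Set.Subsingleton.finite ?_) (Set.toFinite _)
      rintro i ⟨K, hi⟩ j ⟨K', hj⟩
      rw [hi] at hj
      simpa using (List.cons.inj hj).1
    refine Set.Finite.subset (Set.finite_iUnion fun q : reach P [] =>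
      Set.finite_iUnion fun q' : reach P [] => (hF q).image fun i => (q, i, q')) ?_
    rintro ⟨q, i, q'⟩ h
    simp only [Set.mem_iUnion]
    refine ⟨q, q', i, ?_, rfl⟩
    rcases h with h | ⟨h, b, rfl⟩
    · left
      simp only at h
      generalize q.1 = L at h
      generalize hL' : q'.1 = L' at h
      cases h
      exact ⟨L', rfl⟩
    · right
      cases b <;> simp

theorem progAut_eps {X : Type} [Fintype X] {z : Fin k} {P : Prog Sig k X} {t : RTree Sig rank}
    {q q' : reach P []} (h : PStep q.1 none q'.1) (hs : Fin k → Pos t) (π : List (X × Pos t)) :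
    Step (progAut rank z P) t (q, hs, π) (q', hs, π) := by
  by_cases hc : childNo (hs z).1 = 0
  · exact ⟨.test true (.chno z 0), Or.inr ⟨h, _, rfl⟩, rfl, rfl, by simpa [testHolds] using hc⟩
  · exact ⟨.test false (.chno z 0), Or.inr ⟨h, _, rfl⟩, rfl, rfl, by simpa [testHolds] using hc⟩

theorem progAut_complete {X : Type} [Fintype X] (z : Fin k) (P : Prog Sig k X)
    (t : RTree Sig rank) (p : Prog Sig k X) : ∀ (K : List (Prog Sig k X))
    (hR : reach p K ⊆ reach P []) (s s' : (Fin k → Pos t) × List (X × Pos t)), sem t p s s' →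
    Relation.ReflTransGen (Step (progAut rank z P) t)
      (⟨p :: K, hR (self_mem_reach p K)⟩, s.1, s.2) (⟨K, hR (tail_mem_reach p K)⟩, s'.1, s'.2) := by
  induction p with
  | ins i =>
    intro K hR s s' h
    exact .single ⟨i, Or.inl (.ins i K), h⟩
  | skip =>
    rintro K hR s s' rfl
    exact .single (progAut_eps (.skip K) _ _)
  | fail => intro K hR s s' h; exact h.elim
  | seq p q ih1 ih2 =>
    rintro K hR s s' ⟨m, h1, h2⟩
    have r1 : reach p (q :: K) ⊆ reach P [] := fun x hx => hR (Or.inr (Or.inl hx))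
    have r2 : reach q K ⊆ reach P [] := fun x hx => hR (Or.inr (Or.inr hx))
    refine .head (progAut_eps (q' := ⟨p :: q :: K, r1 (self_mem_reach _ _)⟩) (.seq p q K) _ _) ?_
    exact (ih1 _ r1 _ _ h1).trans (ih2 _ r2 _ _ h2)
  | alt p q ih1 ih2 =>
    intro K hR s s' h
    have r1 : reach p K ⊆ reach P [] := fun x hx => hR (Or.inr (Or.inl hx))
    have r2 : reach q K ⊆ reach P [] := fun x hx => hR (Or.inr (Or.inr hx))
    rcases h with h | h
    · exact .head (progAut_eps (q' := ⟨p :: K, r1 (self_mem_reach _ _)⟩) (.altl p q K) _ _)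
        (ih1 _ r1 _ _ h)
    · exact .head (progAut_eps (q' := ⟨q :: K, r2 (self_mem_reach _ _)⟩) (.altr p q K) _ _)
        (ih2 _ r2 _ _ h)
  | star p ih =>
    intro K hR s s' h
    have r1 : reach p (.star p :: K) ⊆ reach P [] := fun x hx => hR (Or.inr hx)
    have h' : Relation.ReflTransGen (sem t p) s s' := h
    clear h
    induction h' using Relation.ReflTransGen.head_induction_on with
    | refl => exact .single (progAut_eps (.star0 p K) _ _)
    | head h1 _ ih' =>
      refine .head (progAut_eps (q' := ⟨p :: .star p :: K, r1 (self_mem_reach _ _)⟩)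
        (.star1 p K) _ _) ?_
      exact (ih _ r1 _ _ h1).trans ih'

def semL {X : Type} (t : RTree Sig rank) : List (Prog Sig k X) →
    (Fin k → Pos t) × List (X × Pos t) → (Fin k → Pos t) × List (X × Pos t) → Prop
  | [], s, s' => s = s'
  | p :: K, s, s' => ∃ m, sem t p s m ∧ semL t K m s'

theorem semL_ins {X : Type} {t : RTree Sig rank} {L L' : List (Prog Sig k X)}
    {i : TInstr Sig k X} (h : PStep L (some i) L')
    {s m s' : (Fin k → Pos t) × List (X × Pos t)} (h1 : instrStep t i s.1 s.2 m.1 m.2)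
    (h2 : semL t L' m s') : semL t L s s' := by
  cases h
  exact ⟨m, h1, h2⟩

theorem semL_eps {X : Type} {t : RTree Sig rank} {L L' : List (Prog Sig k X)}
    (h : PStep L none L')
    {s s' : (Fin k → Pos t) × List (X × Pos t)} (h2 : semL t L' s s') : semL t L s s' := by
  cases h with
  | skip => exact ⟨s, rfl, h2⟩
  | seq p q K =>
    obtain ⟨m, h1, m', h2, h3⟩ := h2
    exact ⟨m', ⟨m, h1, h2⟩, h3⟩
  | altl p q K =>
    obtain ⟨m, h1, h2⟩ := h2
    exact ⟨m, Or.inl h1, h2⟩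
  | altr p q K =>
    obtain ⟨m, h1, h2⟩ := h2
    exact ⟨m, Or.inr h1, h2⟩
  | star0 p K => exact ⟨s, Relation.ReflTransGen.refl, h2⟩
  | star1 p K =>
    obtain ⟨m, h1, m', h2, h3⟩ := h2
    exact ⟨m', Relation.ReflTransGen.head h1 h2, h3⟩

theorem progAut_sound {X : Type} [Fintype X] (z : Fin k) (P : Prog Sig k X)
    (t : RTree Sig rank) {c c' : TConf (progAut rank z P) t}
    (h : Relation.ReflTransGen (Step (progAut rank z P) t) c c') (hc : c'.1.1 = []) :
    semL t c.1.1 c.2 c'.2 := by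
  induction h using Relation.ReflTransGen.head_induction_on with
  | refl => rw [hc]; rfl
  | @head c m h1 _ ih =>
    obtain ⟨i, hi, hs⟩ := h1
    rcases hi with hi | ⟨hi, b, hb⟩
    · exact semL_ins hi hs ih
    · have hb' : i = .test b (.chno z 0) := hb
      subst hb'
      obtain ⟨e1, e2, -⟩ := hs
      have : m.2 = c.2 := Prod.ext e1 e2
      rw [this] at ih
      exact semL_eps hi ih

theorem progAut_accepts {X : Type} [Fintype X] (z : Fin k) (P : Prog Sig k X)
    (t : RTree Sig rank) : Accepts (progAut rank z P) t ↔
      sem t P (fun _ => rootPos t, []) (fun _ => rootPos t, []) := by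
  constructor
  · rintro ⟨q, hq, h, -⟩
    obtain ⟨m, h1, h2⟩ := progAut_sound z P t h hq
    have h3 : m = _ := h2
    rw [h3] at h1
    exact h1
  · intro h
    refine ⟨⟨[], tail_mem_reach P []⟩, rfl, progAut_complete z P t P [] subset_rfl _ _ h, ?_⟩
    rintro c ⟨i, hi, -⟩
    rcases hi with hi | ⟨hi, -⟩ <;> cases hi

end Programs
end NestedPebbles

namespace NestedPebbles
section Dfs
variable {Sig : Type} {rank : Sig → ℕ} {k : ℕ}

theorem lt_snoc_zero {v w : List ℕ} (h : v < w ++ [0]) : v < w ∨ v = w := by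
  induction w generalizing v with
  | nil =>
    cases v with
    | nil => exact Or.inr rfl
    | cons a v =>
      simp [List.cons_lt_cons_iff] at h
  | cons b w ih =>
    cases v with
    | nil => left; exact List.nil_lt_cons _ _
    | cons a v =>
      simp only [List.cons_append, List.cons_lt_cons_iff] at h ⊢
      rcases h with h | ⟨rfl, h⟩
      · exact Or.inl (Or.inl h)
      · rcases ih h with h | rfl
        · exact Or.inl (Or.inr ⟨rfl, h⟩)
        · exact Or.inr rfl

theorem lt_snoc_succ {v w : List ℕ} {j : ℕ} (h : v < w ++ [j + 1]) :
    v < w ++ [j] ∨ w ++ [j] <+: v := by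
  induction w generalizing v with
  | nil =>
    cases v with
    | nil => left; exact List.nil_lt_cons _ _
    | cons a v =>
      simp only [List.nil_append, List.cons_lt_cons_iff, List.not_lt_nil, and_false, or_false,
        List.cons_prefix_cons, List.nil_prefix, and_true] at h ⊢
      omega
  | cons b w ih =>
    cases v with
    | nil => left; exact List.nil_lt_cons _ _
    | cons a v =>
      simp only [List.cons_append, List.cons_lt_cons_iff, List.cons_prefix_cons] at h ⊢
      rcases h with h | ⟨rfl, h⟩
      · exact Or.inl (Or.inl h)
      · rcases ih h with h | h
        · exact Or.inl (Or.inr ⟨rfl, h⟩)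
        · exact Or.inr ⟨rfl, h⟩

theorem nil_pre {l : List ℕ} : [] <+: l := ⟨l, rfl⟩

theorem lt_snoc_of_pre {w r : List ℕ} {i j : ℕ} (h : i < j) :
    w ++ i :: r < w ++ [j] := by
  induction w with
  | nil => simp [List.cons_lt_cons_iff, h]
  | cons b w ih => simp only [List.cons_append, List.cons_lt_cons_iff]; exact Or.inr ⟨trivial, ih⟩

theorem lt_snoc_self (w : List ℕ) (j : ℕ) : w < w ++ [j] := by
  induction w with
  | nil => exact List.nil_lt_cons _ _
  | cons b w ih => simp only [List.cons_append, List.cons_lt_cons_iff]; exact Or.inr ⟨trivial, ih⟩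

/-- `v` is a leaf. -/
def LeafR (t : RTree Sig rank) (v : Pos t) : Prop := ∃ a, labelAt t v.1 = some a ∧ rank a = 0

/-- `v` is the last child of `u`. -/
def UpLast (t : RTree Sig rank) (v u : Pos t) : Prop :=
  ∃ j, v.1 = u.1 ++ [j] ∧ ∃ a, labelAt t u.1 = some a ∧ rank a = j + 1

/-- `u` is the next sibling of `v`. -/
def Sib (t : RTree Sig rank) (v u : Pos t) : Prop :=
  ∃ w j, v.1 = w ++ [j] ∧ u.1 = w ++ [j + 1]

/-- `u` is the successor of `v` in document order. -/
def Nx (t : RTree Sig rank) (v u : Pos t) : Prop :=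
  u.1 = v.1 ++ [0] ∨ ∃ m, LeafR t v ∧ Relation.ReflTransGen (UpLast t) v m ∧ Sib t m u

theorem leaf_pre {t : RTree Sig rank} {l v : Pos t} (h : LeafR t l) (hp : l.1 <+: v.1) :
    v = l := by
  obtain ⟨r, hr⟩ := hp
  cases r with
  | nil => exact pos_ext (by simpa using hr.symm)
  | cons i r =>
    exfalso
    obtain ⟨a, ha, h0⟩ := h
    have h1 : IsPos t (l.1 ++ [i]) := by
      apply isPos_of_append (q := r)
      have := v.2
      rw [← hr] at this
      simpa using this
    obtain ⟨b, hb, hj⟩ := (isPos_snoc _ _ _).1 h1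
    rw [ha] at hb
    cases hb
    omega

/-- Everything before or inside the subtree at `w` satisfies `Φ`. -/
def DoneU {t : RTree Sig rank} (Φ : Pos t → Prop) (w : Pos t) : Prop :=
  ∀ v : Pos t, v.1 < w.1 ∨ w.1 <+: v.1 → Φ v

theorem DoneU.upLast {t : RTree Sig rank} {Φ : Pos t → Prop} {m u : Pos t}
    (h : DoneU Φ m) (hu : UpLast t m u) : DoneU Φ u := by
  obtain ⟨j, hm, a, ha, hr⟩ := hu
  intro v hv
  rcases hv with hv | ⟨r, hr'⟩
  · exact h v (Or.inl (hv.trans (by rw [hm]; exact lt_snoc_self _ _)))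
  · cases r with
    | nil => exact h v (Or.inl (by rw [hm, ← hr', List.append_nil]; exact lt_snoc_self _ _))
    | cons i r =>
      have h1 : IsPos t (u.1 ++ [i]) := by
        apply isPos_of_append (q := r)
        have := v.2
        rw [← hr'] at this
        simpa using this
      obtain ⟨b, hb, hj⟩ := (isPos_snoc _ _ _).1 h1
      rw [ha] at hb
      cases hb
      rcases Nat.lt_or_ge i j with hij | hij
      · exact h v (Or.inl (by rw [hm, ← hr']; exact lt_snoc_of_pre hij))
      · have : i = j := by omega
        subst this
        exact h v (Or.inr ⟨r, by rw [hm, ← hr']; simp⟩)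

theorem DoneU.upLasts {t : RTree Sig rank} {Φ : Pos t → Prop} {m u : Pos t}
    (h : DoneU Φ m) (hu : Relation.ReflTransGen (UpLast t) m u) : DoneU Φ u := by
  induction hu with
  | refl => exact h
  | tail _ h2 ih => exact ih.upLast h2

theorem doneU_leaf {t : RTree Sig rank} {Φ : Pos t → Prop} {l : Pos t}
    (hD : ∀ v : Pos t, v.1 < l.1 → Φ v) (hl : Φ l) (hf : LeafR t l) : DoneU Φ l := by
  intro v hv
  rcases hv with hv | hv
  · exact hD v hv
  · rw [leaf_pre hf hv]; exact hl

theorem dfs_step {t : RTree Sig rank} {Φ : Pos t → Prop} {l u : Pos t}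
    (hD : ∀ v : Pos t, v.1 < l.1 → Φ v) (hl : Φ l) (hn : Nx t l u) :
    ∀ v : Pos t, v.1 < u.1 → Φ v := by
  intro v hv
  rcases hn with hn | ⟨m, hf, hm, w, j, h1, h2⟩
  · rw [hn] at hv
    rcases lt_snoc_zero hv with h | h
    · exact hD v h
    · rw [pos_ext h]; exact hl
  · have hU := (doneU_leaf hD hl hf).upLasts hm
    rw [h2] at hv
    apply hU v
    rw [h1]
    exact lt_snoc_succ hv

theorem dfs_complete (t : RTree Sig rank) (s : RTree Sig rank) : ∀ w : Pos t,
    t.subtree w.1 = some s → ∃ u, Relation.ReflTransGen (Nx t) w u ∧ LeafR t u ∧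
      Relation.ReflTransGen (UpLast t) u w := by
  induction s with
  | node a c ih =>
    intro w hw
    have ha : labelAt t w.1 = some a := by simp [labelAt, hw, RTree.label]
    by_cases h0 : rank a = 0
    · exact ⟨w, .refl, ⟨a, ha, h0⟩, .refl⟩
    have hpos : ∀ j, j < rank a → IsPos t (w.1 ++ [j]) :=
      fun j hj => (isPos_snoc _ _ _).2 ⟨a, ha, hj⟩
    have hsub : ∀ j (hj : j < rank a), t.subtree (w.1 ++ [j]) = some (c ⟨j, hj⟩) := by
      intro j hj
      rw [subtree_append, hw]
      simp [RTree.subtree, RTree.child, hj]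
    have key : ∀ j (hj : j < rank a), ∃ u, Relation.ReflTransGen (Nx t) w u ∧ LeafR t u ∧
        Relation.ReflTransGen (UpLast t) u (mkPos _ (hpos j hj)) := by
      intro j
      induction j with
      | zero =>
        intro hj
        obtain ⟨u, h1, h2, h3⟩ := ih ⟨0, hj⟩ (mkPos _ (hpos 0 hj)) (hsub 0 hj)
        exact ⟨u, .head (Or.inl rfl) h1, h2, h3⟩
      | succ j ihj =>
        intro hj
        obtain ⟨u', g1, g2, g3⟩ := ihj (by omega)
        obtain ⟨u, h1, h2, h3⟩ := ih ⟨j + 1, hj⟩ (mkPos _ (hpos (j + 1) hj)) (hsub _ hj)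
        exact ⟨u, (g1.tail (Or.inr ⟨_, g2, g3, w.1, j, rfl, rfl⟩)).trans h1, h2, h3⟩
    obtain ⟨u, h1, h2, h3⟩ := key (rank a - 1) (by omega)
    exact ⟨u, h1, h2, h3.tail ⟨rank a - 1, rfl, a, ha, by omega⟩⟩

theorem dfs_iff (t : RTree Sig rank) (Φ : Pos t → Prop) :
    (∃ l, Relation.ReflTransGen (fun v u => Φ v ∧ Nx t v u) (rootPos t) l ∧ Φ l ∧ LeafR t l ∧
      Relation.ReflTransGen (UpLast t) l (rootPos t)) ↔ ∀ u, Φ u := by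
  constructor
  · rintro ⟨l, h1, h2, h3, h4⟩ u
    have hD : ∀ v : Pos t, v.1 < l.1 → Φ v := by
      induction h1 with
      | refl => intro v hv; exact absurd hv (List.not_lt_nil _)
      | @tail b c hb hc ih =>
        refine dfs_step ?_ hc.1 hc.2
        -- re-run the invariant for the predecessor
        clear h2 h3 h4 ih hc
        induction hb with
        | refl => intro v hv; exact absurd hv (List.not_lt_nil _)
        | tail _ hc ih => exact dfs_step ih hc.1 hc.2
    exact (doneU_leaf hD h2 h3).upLasts h4 u (Or.inr (nil_pre))
  · intro h
    obtain ⟨l, h1, h2, h3⟩ := dfs_complete t t (rootPos t) rfl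
    exact ⟨l, Relation.ReflTransGen.mono (fun a b hab => ⟨h a, hab⟩) _ _ h1, h l, h2, h3⟩

end Dfs
end NestedPebbles

namespace NestedPebbles
section Combinators
variable {Sig : Type} {rank : Sig → ℕ} {k : ℕ} {X : Type}

/-- Exact one-head relation. -/
def HR (t : RTree Sig rank) (π : List (X × Pos t)) (i : Fin k) (P : Prog Sig k X)
    (r : Pos t → Pos t → Prop) : Prop :=
  ∀ hs s', sem t P (hs, π) s' ↔ ∃ u, r (hs i) u ∧ s' = (Function.update hs i u, π)

/-- One-head relation, with the other heads uncontrolled. -/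
def WR (t : RTree Sig rank) (π : List (X × Pos t)) (i : Fin k) (P : Prog Sig k X)
    (r : Pos t → Pos t → Prop) : Prop :=
  (∀ hs s', sem t P (hs, π) s' → s'.2 = π ∧ r (hs i) (s'.1 i)) ∧
  ∀ hs u, r (hs i) u → ∃ hs', hs' i = u ∧ sem t P (hs, π) (hs', π)

def TS (t : RTree Sig rank) (π : List (X × Pos t)) (P : Prog Sig k X) (φ : Prop) : Prop :=
  ∀ hs s', sem t P (hs, π) s' ↔ s'.2 = π ∧ φ

variable {t : RTree Sig rank} {π : List (X × Pos t)} {i : Fin k} {P Q : Prog Sig k X}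
  {r r' : Pos t → Pos t → Prop}

theorem HR.congr (h : HR t π i P r) (hr : ∀ v u, r v u ↔ r' v u) : HR t π i P r' := by
  have : r = r' := funext fun v => funext fun u => propext (hr v u)
  exact this ▸ h

theorem WR.congr (h : WR t π i P r) (hr : ∀ v u, r v u ↔ r' v u) : WR t π i P r' := by
  have : r = r' := funext fun v => funext fun u => propext (hr v u)
  exact this ▸ h

theorem TS.congr {φ ψ : Prop} (h : TS t π P φ) (hr : φ ↔ ψ) : TS t π P ψ := propext hr ▸ h

theorem HR.seq (h : HR t π i P r) (h' : HR t π i Q r') :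
    HR t π i (.seq P Q) (fun v u => ∃ m, r v m ∧ r' m u) := by
  intro hs s'
  constructor
  · rintro ⟨m, h1, h2⟩
    obtain ⟨u, hu, rfl⟩ := (h _ _).1 h1
    obtain ⟨w, hw, rfl⟩ := (h' _ _).1 h2
    rw [Function.update_self] at hw
    exact ⟨w, ⟨u, hu, hw⟩, by simp⟩
  · rintro ⟨w, ⟨u, hu, hw⟩, rfl⟩
    refine ⟨(Function.update hs i u, π), (h _ _).2 ⟨u, hu, rfl⟩, (h' _ _).2 ⟨w, ?_, by simp⟩⟩
    rwa [Function.update_self]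

theorem HR.alt (h : HR t π i P r) (h' : HR t π i Q r') :
    HR t π i (.alt P Q) (fun v u => r v u ∨ r' v u) := by
  intro hs s'
  change (sem t P _ _ ∨ sem t Q _ _) ↔ _
  rw [h hs s', h' hs s']
  constructor
  · rintro (⟨u, h1, h2⟩ | ⟨u, h1, h2⟩)
    · exact ⟨u, Or.inl h1, h2⟩
    · exact ⟨u, Or.inr h1, h2⟩
  · rintro ⟨u, h1 | h1, h2⟩
    · exact Or.inl ⟨u, h1, h2⟩
    · exact Or.inr ⟨u, h1, h2⟩

theorem HR.fail : HR t π i (.fail : Prog Sig k X) (fun _ _ => False) := by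
  intro hs s'
  simp [sem]

theorem HR.star (h : HR t π i P r) : HR t π i (.star P) (Relation.ReflTransGen r) := by
  intro hs s'
  constructor
  · intro h1
    change Relation.ReflTransGen (sem t P) _ _ at h1
    induction h1 with
    | refl => exact ⟨hs i, .refl, by simp⟩
    | tail _ h2 ih =>
      obtain ⟨u, hu, rfl⟩ := ih
      obtain ⟨w, hw, rfl⟩ := (h _ _).1 h2
      rw [Function.update_self] at hw
      exact ⟨w, hu.tail hw, by simp⟩
  · rintro ⟨u, hu, rfl⟩
    change Relation.ReflTransGen (sem t P) _ _
    induction hu with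
    | refl => rw [Function.update_eq_self]
    | @tail u w _ h2 ih =>
      refine ih.tail ((h _ _).2 ⟨w, ?_, by simp⟩)
      rwa [Function.update_self]

theorem HR.toWR (h : HR t π i P r) : WR t π i P r := by
  refine ⟨fun hs s' hh => ?_, fun hs u hu => ?_⟩
  · obtain ⟨u, hu, rfl⟩ := (h _ _).1 hh
    simpa using hu
  · exact ⟨Function.update hs i u, by simp, (h _ _).2 ⟨u, hu, rfl⟩⟩

theorem WR.seq (h : WR t π i P r) (h' : WR t π i Q r') :
    WR t π i (.seq P Q) (fun v u => ∃ m, r v m ∧ r' m u) := by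
  refine ⟨fun hs s' hh => ?_, fun hs u hu => ?_⟩
  · obtain ⟨⟨m, π1⟩, h1, h2⟩ := hh
    obtain ⟨e, h3⟩ := h.1 _ _ h1
    simp only at e
    subst e
    obtain ⟨e, h4⟩ := h'.1 _ _ h2
    exact ⟨e, _, h3, h4⟩
  · obtain ⟨m, h1, h2⟩ := hu
    obtain ⟨hs1, rfl, h3⟩ := h.2 _ _ h1
    obtain ⟨hs2, rfl, h4⟩ := h'.2 _ _ h2
    exact ⟨hs2, rfl, _, h3, h4⟩

theorem WR.star (h : WR t π i P r) : WR t π i (.star P) (Relation.ReflTransGen r) := by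
  refine ⟨fun hs s' hh => ?_, fun hs u hu => ?_⟩
  · change Relation.ReflTransGen (sem t P) _ _ at hh
    induction hh with
    | refl => exact ⟨rfl, .refl⟩
    | @tail m s _ h2 ih =>
      obtain ⟨m, π1⟩ := m
      obtain ⟨e, h3⟩ := ih
      simp only at e
      subst e
      obtain ⟨e, h4⟩ := h.1 _ _ h2
      exact ⟨e, h3.tail h4⟩
  · change ∃ hs' : Fin k → Pos t, hs' i = u ∧ Relation.ReflTransGen (sem t P) _ _
    induction hu with
    | refl => exact ⟨hs, rfl, .refl⟩
    | tail _ h2 ih =>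
      obtain ⟨hs1, rfl, h3⟩ := ih
      obtain ⟨hs2, rfl, h4⟩ := h.2 _ _ h2
      exact ⟨hs2, rfl, h3.tail h4⟩

theorem HR.test {τ : TTest Sig k X} {b : Bool} {c : Pos t → Prop}
    (hc : ∀ hs, testHolds t τ hs π ↔ c (hs i)) :
    HR t π i (.ins (.test b τ)) (fun v u => u = v ∧ (c v ↔ b = true)) := by
  rintro hs ⟨hs', π'⟩
  change (hs' = hs ∧ π' = π ∧ (testHolds t τ hs π ↔ b = true)) ↔ _
  rw [hc]
  constructor
  · rintro ⟨rfl, rfl, h⟩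
    exact ⟨hs' i, ⟨rfl, h⟩, by simp⟩
  · rintro ⟨u, ⟨rfl, h⟩, e⟩
    simp only [Function.update_eq_self, Prod.mk.injEq] at e
    exact ⟨e.1, e.2, h⟩

theorem HR.up : HR t π i (.ins (.up i) : Prog Sig k X) (fun v u => ∃ j, v.1 = u.1 ++ [j]) := by
  rintro hs ⟨hs', π'⟩
  change (π' = π ∧ (∃ j : ℕ, (hs i).1 = (hs' i).1 ++ [j]) ∧ ∀ h, h ≠ i → hs' h = hs h) ↔ _
  constructor
  · rintro ⟨rfl, h, h'⟩
    exact ⟨hs' i, h, by rw [Function.eq_update_iff.2 ⟨rfl, h'⟩]; simp⟩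
  · rintro ⟨u, h, e⟩
    simp only [Prod.mk.injEq] at e
    obtain ⟨rfl, rfl⟩ := e
    exact ⟨rfl, by simpa using h, fun h hh => by simp [hh]⟩

theorem HR.down (j : ℕ) : HR t π i (.ins (.down i j) : Prog Sig k X)
    (fun v u => 1 ≤ j ∧ u.1 = v.1 ++ [j - 1]) := by
  rintro hs ⟨hs', π'⟩
  change (π' = π ∧ 1 ≤ j ∧ (hs' i).1 = (hs i).1 ++ [j - 1] ∧ ∀ h, h ≠ i → hs' h = hs h) ↔ _
  constructor
  · rintro ⟨rfl, h0, h, h'⟩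
    exact ⟨hs' i, ⟨h0, h⟩, by rw [Function.eq_update_iff.2 ⟨rfl, h'⟩]; simp⟩
  · rintro ⟨u, ⟨h0, h⟩, e⟩
    simp only [Prod.mk.injEq] at e
    obtain ⟨rfl, rfl⟩ := e
    exact ⟨rfl, h0, by simpa using h, fun h hh => by simp [hh]⟩

/-- Finite choice. -/
def altL {α : Type} (f : α → Prog Sig k X) : List α → Prog Sig k X
  | [] => .fail
  | a :: L => .alt (f a) (altL f L)

theorem HR.altL {α : Type} {f : α → Prog Sig k X} {R : α → Pos t → Pos t → Prop}
    (L : List α) (h : ∀ a ∈ L, HR t π i (f a) (R a)) :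
    HR t π i (altL f L) (fun v u => ∃ a ∈ L, R a v u) := by
  induction L with
  | nil => exact HR.fail.congr (by simp)
  | cons a L ih =>
    exact ((h a (by simp)).alt (ih fun b hb => h b (by simp [hb]))).congr (by simp)

theorem HR.chno (b : Bool) (j : ℕ) : HR t π i (.ins (.test b (.chno i j)) : Prog Sig k X)
    (fun v u => u = v ∧ (childNo v.1 = j ↔ b = true)) :=
  HR.test (c := fun v => childNo v.1 = j) fun _ => Iff.rfl

theorem HR.lab (b : Bool) (a : Sig) : HR t π i (.ins (.test b (.lab i a)) : Prog Sig k X)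
    (fun v u => u = v ∧ (labelAt t v.1 = some a ↔ b = true)) :=
  HR.test (c := fun v => labelAt t v.1 = some a) fun _ => Iff.rfl

theorem HR.peb (b : Bool) (x : X) : HR t π i (.ins (.test b (.peb i x)) : Prog Sig k X)
    (fun v u => u = v ∧ ((x, v) ∈ π ↔ b = true)) :=
  HR.test (c := fun v => (x, v) ∈ π) fun _ => Iff.rfl

/-- Move head `i` to the root. -/
def toRoot (i : Fin k) : Prog Sig k X :=
  .seq (.star (.ins (.up i))) (.ins (.test true (.chno i 0)))

theorem ups_iff {v u : Pos t} :
    Relation.ReflTransGen (fun v u : Pos t => ∃ j, v.1 = u.1 ++ [j]) v u ↔ u.1 <+: v.1 := by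
  constructor
  · intro h
    induction h with
    | refl => exact List.prefix_rfl
    | tail _ h2 ih =>
      obtain ⟨j, hj⟩ := h2
      exact (List.prefix_append _ [j]).trans (hj ▸ ih)
  · rintro ⟨r, hr⟩
    induction r using List.reverseRecOn generalizing v with
    | nil => rw [pos_ext (t := t) (u := u) (v := v) (by simpa using hr)]
    | append_singleton r j ih =>
      rw [← List.append_assoc] at hr
      have hp : IsPos t (u.1 ++ r) := isPos_of_append (q := [j]) (by rw [hr]; exact v.2)
      exact .head (b := mkPos _ hp) ⟨j, hr.symm⟩ (ih rfl)

theorem HR.toRoot : HR t π i (toRoot i : Prog Sig k X) (fun _ u => u = rootPos t) := by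
  refine (HR.up.star.seq (HR.chno true 0)).congr fun v u => ?_
  constructor
  · rintro ⟨m, -, rfl, h⟩
    exact pos_ext (childNo_zero.1 (h.2 rfl))
  · rintro rfl
    exact ⟨_, ups_iff.2 nil_pre, rfl, by simp [rootPos]⟩

/-- Move head `i` down to some child. -/
def downAny (M : ℕ) (i : Fin k) : Prog Sig k X :=
  altL (fun j => .ins (.down i (j + 1))) (List.range M)

theorem HR.downAny {M : ℕ} (hM : ∀ a, rank a ≤ M) : HR t π i (downAny M i : Prog Sig k X)
    (fun v u => ∃ j, u.1 = v.1 ++ [j]) := by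
  refine (HR.altL _ (fun j _ => HR.down (j + 1))).congr fun v u => ?_
  constructor
  · rintro ⟨j, -, -, h⟩
    exact ⟨j, h⟩
  · rintro ⟨j, h⟩
    have h1 := u.2
    rw [h] at h1
    obtain ⟨a, -, ha⟩ := (isPos_snoc _ _ _).1 h1
    exact ⟨j, List.mem_range.2 (ha.trans_le (hM a)), by omega, h⟩

/-- Move head `i` anywhere. -/
def anywhere (M : ℕ) (i : Fin k) : Prog Sig k X := .seq (toRoot i) (.star (downAny M i))

theorem HR.anywhere {M : ℕ} (hM : ∀ a, rank a ≤ M) :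
    HR t π i (anywhere M i : Prog Sig k X) (fun _ _ => True) := by
  refine (HR.toRoot.seq (HR.downAny hM).star).congr fun v u => ?_
  simp only [iff_true, exists_eq_left]
  have h := ups_iff.2 (show (rootPos t).1 <+: u.1 from nil_pre)
  rw [← Relation.reflTransGen_swap] at h
  exact h

/-- Sequential composition over a list. -/
def seqL {α : Type} (f : α → Prog Sig k X) : List α → Prog Sig k X
  | [] => .skip
  | a :: L => .seq (f a) (seqL f L)

theorem seqL_place {f : Fin k → Prog Sig k X} {r : Fin k → Pos t → Prop}
    (h : ∀ i, HR t π i (f i) (fun _ u => r i u)) (L : List (Fin k)) (hL : L.Nodup) :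
    ∀ hs s', sem t (seqL f L) (hs, π) s' ↔
      s'.2 = π ∧ (∀ i ∈ L, r i (s'.1 i)) ∧ ∀ i, i ∉ L → s'.1 i = hs i := by
  induction L with
  | nil =>
    rintro hs ⟨hs', π'⟩
    simp only [seqL, sem, Prod.mk.injEq, List.not_mem_nil, false_imp_iff, implies_true,
      not_false_eq_true, forall_const, true_and]
    constructor
    · rintro ⟨rfl, rfl⟩; simp
    · rintro ⟨rfl, hh⟩; exact ⟨(funext hh).symm, rfl⟩
  | cons a L ih =>
    intro hs s'
    have hL' := List.nodup_cons.1 hL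
    change (∃ m, sem t (f a) _ m ∧ sem t (seqL f L) m s') ↔ _
    constructor
    · rintro ⟨m, h1, h2⟩
      obtain ⟨u, hu, rfl⟩ := (h a _ _).1 h1
      obtain ⟨e1, e2, e3⟩ := (ih hL'.2 _ _).1 h2
      refine ⟨e1, fun i hi => ?_, fun i hi => ?_⟩
      · rcases List.mem_cons.1 hi with rfl | hi
        · rw [e3 _ hL'.1, Function.update_self]; exact hu
        · exact e2 i hi
      · rw [List.mem_cons, not_or] at hi
        rw [e3 _ hi.2, Function.update_of_ne hi.1]
    · rintro ⟨e1, e2, e3⟩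
      refine ⟨(Function.update hs a (s'.1 a), π), (h a _ _).2 ⟨_, e2 a (by simp), rfl⟩,
        (ih hL'.2 _ _).2 ⟨e1, fun i hi => e2 i (by simp [hi]), fun i hi => ?_⟩⟩
      by_cases hia : i = a
      · subst hia; simp
      · rw [Function.update_of_ne hia]; exact e3 i (by simp [hia, hi])

/-- Move all heads anywhere. -/
def scr (M : ℕ) : Prog Sig k X := seqL (anywhere M) (List.finRange k)

theorem sem_scr {M : ℕ} (hM : ∀ a, rank a ≤ M) (hs : Fin k → Pos t)
    (s' : (Fin k → Pos t) × List (X × Pos t)) :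
    sem t (scr M : Prog Sig k X) (hs, π) s' ↔ s'.2 = π := by
  rw [scr, seqL_place (r := fun _ _ => True) (fun i => HR.anywhere hM) _ (List.nodup_finRange k)]
  simp

theorem WR.toTS {M : ℕ} (hM : ∀ a, rank a ≤ M) {φ : Prop} (h : WR t π i P r)
    (hr : ∀ v, (∃ u, r v u) ↔ φ) : TS t π (.seq P (scr M)) φ := by
  intro hs s'
  constructor
  · rintro ⟨⟨hs1, π1⟩, h1, h2⟩
    obtain ⟨e, h3⟩ := h.1 _ _ h1
    simp only at e
    subst e
    exact ⟨(sem_scr hM _ _).1 h2, (hr _).1 ⟨_, h3⟩⟩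
  · rintro ⟨e, hφ⟩
    obtain ⟨u, hu⟩ := (hr (hs i)).2 hφ
    obtain ⟨hs1, -, h1⟩ := h.2 _ _ hu
    exact ⟨_, h1, (sem_scr hM _ _).2 e⟩

theorem TS.and {φ ψ : Prop} (h : TS t π P φ) (h' : TS t π Q ψ) :
    TS t π (.seq P Q) (φ ∧ ψ) := by
  intro hs s'
  constructor
  · rintro ⟨⟨hs1, π1⟩, h1, h2⟩
    obtain ⟨e, h3⟩ := (h _ _).1 h1
    simp only at e
    subst e
    obtain ⟨e, h4⟩ := (h' _ _).1 h2
    exact ⟨e, h3, h4⟩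
  · rintro ⟨e, h1, h2⟩
    exact ⟨(hs, π), (h _ _).2 ⟨rfl, h1⟩, (h' _ _).2 ⟨e, h2⟩⟩

theorem TS.or {φ ψ : Prop} (h : TS t π P φ) (h' : TS t π Q ψ) :
    TS t π (.alt P Q) (φ ∨ ψ) := by
  intro hs s'
  change (sem t P _ _ ∨ sem t Q _ _) ↔ _
  rw [h hs s', h' hs s']
  tauto

end Combinators
end NestedPebbles

namespace NestedPebbles
section Quantifiers
variable {Sig : Type} {rank : Sig → ℕ} {k : ℕ} {X : Type}

/-- Move head `i` to pebble `x`. -/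
def goto (M : ℕ) (i : Fin k) (x : X) : Prog Sig k X :=
  .seq (anywhere M i) (.ins (.test true (.peb i x)))

variable {t : RTree Sig rank} {π : List (X × Pos t)} {i : Fin k} {P Q : Prog Sig k X}

theorem HR.goto {M : ℕ} (hM : ∀ a, rank a ≤ M) (x : X) :
    HR t π i (goto M i x : Prog Sig k X) (fun _ u => (x, u) ∈ π) := by
  refine ((HR.anywhere hM).seq (HR.peb true x)).congr fun v u => ?_
  constructor
  · rintro ⟨m, -, rfl, h⟩
    exact h.2 rfl
  · intro h
    exact ⟨u, trivial, rfl, by simp [h]⟩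

/-- Leaf test. -/
def leafP (rank : Sig → ℕ) (L : List Sig) (z : Fin k) : Prog Sig k X :=
  altL (fun a => .ins (.test true (.lab z a))) (L.filter fun a => rank a == 0)

theorem HR.leafP {L : List Sig} (hL : ∀ a, a ∈ L) :
    HR t π i (leafP rank L i : Prog Sig k X) (fun v u => u = v ∧ LeafR t v) := by
  refine (HR.altL _ (fun a _ => HR.lab true a)).congr fun v u => ?_
  constructor
  · rintro ⟨a, ha, rfl, h⟩
    exact ⟨rfl, a, h.2 rfl, by simpa using (List.mem_filter.1 ha).2⟩
  · rintro ⟨rfl, a, ha, h⟩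
    exact ⟨a, List.mem_filter.2 ⟨hL a, by simpa using h⟩, rfl, by simp [ha]⟩

/-- Move up from the last child. -/
def upLastP (rank : Sig → ℕ) (L : List Sig) (z : Fin k) : Prog Sig k X :=
  altL (fun a => .seq (.ins (.test true (.chno z (rank a))))
    (.seq (.ins (.up z)) (.ins (.test true (.lab z a))))) L

theorem HR.upLastP {L : List Sig} (hL : ∀ a, a ∈ L) :
    HR t π i (upLastP rank L i : Prog Sig k X) (UpLast t) := by
  refine (HR.altL _ (fun a _ => (HR.chno true (rank a)).seq
    (HR.up.seq (HR.lab true a)))).congr fun v u => ?_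
  constructor
  · rintro ⟨a, -, m, ⟨rfl, h1⟩, m', ⟨j, hj⟩, rfl, h2⟩
    have h1 := h1.2 rfl
    rw [hj, childNo_snoc] at h1
    exact ⟨j, hj, a, h2.2 rfl, h1.symm⟩
  · rintro ⟨j, hj, a, ha, hr⟩
    exact ⟨a, hL a, v, ⟨rfl, by simp [hj, hr]⟩, u, ⟨j, hj⟩, rfl, by simp [ha]⟩

/-- Move to the next sibling. -/
def sibP (M : ℕ) (z : Fin k) : Prog Sig k X :=
  altL (fun j => .seq (.ins (.test true (.chno z (j + 1))))
    (.seq (.ins (.up z)) (.ins (.down z (j + 2))))) (List.range M)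

theorem HR.sibP {M : ℕ} (hM : ∀ a, rank a ≤ M) :
    HR t π i (sibP M i : Prog Sig k X) (Sib t) := by
  refine (HR.altL _ (fun j _ => (HR.chno true (j + 1)).seq
    (HR.up.seq (HR.down (j + 2))))).congr fun v u => ?_
  constructor
  · rintro ⟨a, -, m, ⟨rfl, h1⟩, m', ⟨j, hj⟩, -, h2⟩
    have h1 := h1.2 rfl
    rw [hj, childNo_snoc] at h1
    have : j = a := by omega
    subst this
    exact ⟨m'.1, j, hj, h2⟩
  · rintro ⟨w, j, hv, hu⟩
    have h1 := u.2
    rw [hu] at h1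
    obtain ⟨a, -, ha⟩ := (isPos_snoc _ _ _).1 h1
    exact ⟨j, List.mem_range.2 (by have := hM a; omega), v, ⟨rfl, by simp [hv]⟩,
      mkPos w (isPos_of_append h1), ⟨j, hv⟩, by omega, hu⟩

/-- Move to the successor in document order. -/
def nxP (rank : Sig → ℕ) (L : List Sig) (M : ℕ) (z : Fin k) : Prog Sig k X :=
  .alt (.ins (.down z 1)) (.seq (leafP rank L z) (.seq (.star (upLastP rank L z)) (sibP M z)))

theorem HR.nxP {L : List Sig} (hL : ∀ a, a ∈ L) {M : ℕ} (hM : ∀ a, rank a ≤ M) :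
    HR t π i (nxP rank L M i : Prog Sig k X) (Nx t) := by
  refine ((HR.down 1).alt ((HR.leafP hL).seq ((HR.upLastP hL).star.seq (HR.sibP hM)))).congr
    fun v u => ?_
  constructor
  · rintro (⟨-, h⟩ | ⟨m, ⟨rfl, h1⟩, m', h2, h3⟩)
    · exact Or.inl h
    · exact Or.inr ⟨m', h1, h2, h3⟩
  · rintro (h | ⟨m, h1, h2, h3⟩)
    · exact Or.inl ⟨le_rfl, h⟩
    · exact Or.inr ⟨v, ⟨rfl, h1⟩, m, h2, h3⟩

/-- Run `T` with pebble `x` at the position of head `z`. -/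
def withPeb (z : Fin k) (x : X) (T : Prog Sig k X) : Prog Sig k X :=
  .seq (.ins (.dropPeb z x)) (.seq T (.ins (.retrieve x)))

/-- Check `T` at the position of head `z`. -/
def checkP (M : ℕ) (z : Fin k) (x : X) (T : Prog Sig k X) : Prog Sig k X :=
  withPeb z x (.seq T (goto M z x))

theorem sem_withPeb {x : X} {T : Prog Sig k X} (hx : ∀ w, (x, w) ∉ π) (hs : Fin k → Pos t)
    {R : (Fin k → Pos t) → Prop}
    (hT : ∀ s', sem t T (hs, (x, hs i) :: π) s' ↔ s'.2 = (x, hs i) :: π ∧ R s'.1)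
    (s' : (Fin k → Pos t) × List (X × Pos t)) :
    sem t (withPeb i x T) (hs, π) s' ↔ s'.2 = π ∧ R s'.1 := by
  constructor
  · rintro ⟨⟨m, π1⟩, h1, ⟨m', π2⟩, h2, h3⟩
    obtain ⟨e1, e2, -⟩ := h1
    simp only at e1 e2
    subst e1 e2
    obtain ⟨e3, h4⟩ := (hT _).1 h2
    simp only at e3
    subst e3
    obtain ⟨e5, w, e6⟩ := h3
    simp only at e5 e6
    simp only [List.cons.injEq] at e6
    exact ⟨e6.2.symm, e5 ▸ h4⟩
  · obtain ⟨hs', π'⟩ := s'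
    rintro ⟨rfl, hR⟩
    exact ⟨(hs, (x, hs i) :: π'), ⟨rfl, rfl, hx⟩, (hs', (x, hs i) :: π'), (hT _).2 ⟨rfl, hR⟩,
      rfl, _, rfl⟩

theorem WR.checkP {M : ℕ} (hM : ∀ a, rank a ≤ M) {x : X} {T : Prog Sig k X}
    (hx : ∀ w, (x, w) ∉ π) {Φ : Pos t → Prop} (hT : ∀ u, TS t ((x, u) :: π) T (Φ u)) :
    WR t π i (checkP M i x T) (fun v u => Φ v ∧ u = v) := by
  have key : ∀ hs s', sem t (NestedPebbles.checkP M i x T) (hs, π) s' ↔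
      s'.2 = π ∧ (Φ (hs i) ∧ s'.1 i = hs i) := by
    intro hs s'
    refine sem_withPeb (R := fun h' => Φ (hs i) ∧ h' i = hs i) hx hs ?_ s'
    intro s'
    constructor
    · rintro ⟨⟨m, π1⟩, h1, h2⟩
      obtain ⟨e, h3⟩ := (hT _ _ _).1 h1
      simp only at e
      subst e
      obtain ⟨u, hu, rfl⟩ := (HR.goto hM x _ _).1 h2
      rcases List.mem_cons.1 hu with hu | hu
      · exact ⟨rfl, h3, by simpa using hu⟩
      · exact absurd hu (hx _)
    · rintro ⟨e, h3, h4⟩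
      obtain ⟨s1, s2⟩ := s'
      simp only at e h4
      subst e
      refine ⟨(s1, _), (hT _ _ _).2 ⟨rfl, h3⟩, (HR.goto hM x _ _).2 ⟨hs i, by simp, ?_⟩⟩
      rw [← h4, Function.update_eq_self]
  refine ⟨fun hs s' h => ?_, fun hs u hu => ⟨Function.update hs i u, by simp, ?_⟩⟩
  · exact (key _ _).1 h
  · exact (key _ _).2 ⟨rfl, hu.1, by simpa using hu.2⟩

/-- Existential quantification. -/
def exP (M : ℕ) (z : Fin k) (x : X) (T : Prog Sig k X) : Prog Sig k X :=
  .seq (.seq (anywhere M z) (checkP M z x T)) (scr M)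

/-- Universal quantification by depth-first search. -/
def allP (rank : Sig → ℕ) (L : List Sig) (M : ℕ) (z : Fin k) (x : X) (T : Prog Sig k X) :
    Prog Sig k X :=
  .seq (.seq (toRoot z) (.seq (.star (.seq (checkP M z x T) (nxP rank L M z)))
    (.seq (checkP M z x T) (.seq (leafP rank L z)
      (.seq (.star (upLastP rank L z)) (.ins (.test true (.chno z 0)))))))) (scr M)

theorem TS.exP {M : ℕ} (hM : ∀ a, rank a ≤ M) {x : X} {T : Prog Sig k X}
    (hx : ∀ w, (x, w) ∉ π) {Φ : Pos t → Prop} (hT : ∀ u, TS t ((x, u) :: π) T (Φ u)) :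
    TS t π (exP M i x T) (∃ u, Φ u) := by
  refine ((HR.anywhere hM).toWR.seq (WR.checkP (i := i) hM hx hT)).toTS hM fun v => ?_
  simp

theorem TS.allP {L : List Sig} (hL : ∀ a, a ∈ L) {M : ℕ} (hM : ∀ a, rank a ≤ M)
    {x : X} {T : Prog Sig k X}
    (hx : ∀ w, (x, w) ∉ π) {Φ : Pos t → Prop} (hT : ∀ u, TS t ((x, u) :: π) T (Φ u)) :
    TS t π (allP rank L M i x T) (∀ u, Φ u) := by
  have hck := WR.checkP (i := i) hM hx hT
  refine (HR.toRoot.toWR.seq ((hck.seq (HR.nxP hL hM).toWR).star.seq (hck.seq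
    ((HR.leafP hL).toWR.seq ((HR.upLastP hL).star.toWR.seq
      (HR.chno true 0).toWR))))).toTS hM fun v => ?_
  rw [← dfs_iff t Φ]
  have e : (fun v u => ∃ m, (Φ v ∧ m = v) ∧ Nx t m u) = fun v u => Φ v ∧ Nx t v u := by
    funext v u
    refine propext ⟨?_, fun h => ⟨v, ⟨h.1, rfl⟩, h.2⟩⟩
    rintro ⟨m, ⟨h, rfl⟩, h'⟩
    exact ⟨h, h'⟩
  rw [e]
  constructor
  · rintro ⟨u, m, rfl, l, h1, m2, ⟨h2, rfl⟩, m3, ⟨rfl, h3⟩, m4, h4, rfl, h5⟩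
    have : u = rootPos t := pos_ext (childNo_zero.1 (h5.2 rfl))
    subst this
    exact ⟨m3, h1, h2, h3, h4⟩
  · rintro ⟨l, h1, h2, h3, h4⟩
    exact ⟨rootPos t, _, rfl, l, h1, l, ⟨h2, rfl⟩, l, ⟨rfl, h3⟩, _, h4, rfl, by simp [rootPos]⟩

end Quantifiers
end NestedPebbles

namespace NestedPebbles
section Compile
variable {Sig : Type} {rank : Sig → ℕ} {k : ℕ} {X : Type}

/-- The stack of the first `d` pebbles. -/
def pstack {t : RTree Sig rank} (pb : ℕ → X) (p : ℕ → Pos t) : ℕ → List (X × Pos t)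
  | 0 => []
  | d + 1 => (pb d, p d) :: pstack pb p d

theorem pstack_congr {t : RTree Sig rank} (pb : ℕ → X) {p p' : ℕ → Pos t} (d : ℕ)
    (h : ∀ x, x < d → p x = p' x) : pstack pb p d = pstack pb p' d := by
  induction d with
  | zero => rfl
  | succ d ih => simp only [pstack]; rw [h d (by omega), ih fun x hx => h x (by omega)]

theorem mem_pstack {t : RTree Sig rank} {pb : ℕ → X} {N : ℕ}
    (hpb : ∀ x < N, ∀ y < N, pb x = pb y → x = y) {p : ℕ → Pos t} {d x : ℕ} (hx : x < N)
    (hd : d ≤ N) (u : Pos t) : (pb x, u) ∈ pstack pb p d ↔ x < d ∧ u = p x := by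
  induction d with
  | zero => simp [pstack]
  | succ d ih =>
    simp only [pstack, List.mem_cons, Prod.mk.injEq]
    rw [ih (by omega)]
    constructor
    · rintro (⟨h, rfl⟩ | ⟨h, rfl⟩)
      · have := hpb x hx d (by omega) h
        subst this
        exact ⟨by omega, rfl⟩
      · exact ⟨by omega, rfl⟩
    · rintro ⟨h, rfl⟩
      rcases Nat.lt_or_ge x d with h1 | h1
      · exact Or.inr ⟨h1, rfl⟩
      · have : x = d := by omega
        subst this
        exact Or.inl ⟨rfl, rfl⟩

/-- Drop `n` pebbles from number `d` on, at the heads. -/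
def dropP (pb : ℕ → X) (d : ℕ) : ℕ → Prog Sig k X
  | 0 => .skip
  | n + 1 => .seq (dropP pb d n)
      (if h : n < k then .ins (.dropPeb ⟨n, h⟩ (pb (d + n))) else .fail)

/-- Retrieve `n` pebbles down to number `d`. -/
def retrP (pb : ℕ → X) (d : ℕ) : ℕ → Prog Sig k X
  | 0 => .skip
  | n + 1 => .seq (.ins (.retrieve (pb (d + n)))) (retrP pb d n)

/-- Place all heads. -/
def placeP (pb : ℕ → X) (M : ℕ) (f : Fin k → ℕ) : Prog Sig k X :=
  seqL (fun i => goto M i (pb (f i))) (List.finRange k)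

/-- Test the places of all heads. -/
def testP (pb : ℕ → X) (f : Fin k → ℕ) : Prog Sig k X :=
  seqL (fun i => .ins (.test true (.peb i (pb (f i))))) (List.finRange k)

variable {t : RTree Sig rank} {pb : ℕ → X} {N : ℕ}

theorem sem_dropP (hpb : ∀ x < N, ∀ y < N, pb x = pb y → x = y) {p : ℕ → Pos t} {d : ℕ}
    {hs : Fin k → Pos t} (n : ℕ) (hn : n ≤ k) (hN : d + n ≤ N)
    (hp : ∀ i : Fin k, p (d + i.1) = hs i) (s' : (Fin k → Pos t) × List (X × Pos t)) :
    sem t (dropP pb d n) (hs, pstack pb p d) s' ↔ s' = (hs, pstack pb p (d + n)) := by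
  induction n generalizing s' with
  | zero => exact eq_comm
  | succ n ih =>
    have hnk : n < k := hn
    change (∃ m, sem t (dropP pb d n) _ m ∧ sem t (if h : n < k then _ else _) m s') ↔ _
    simp only [ih (by omega) (by omega), exists_eq_left, dif_pos hnk]
    have hfresh : ∀ w, (pb (d + n), w) ∉ pstack pb p (d + n) := by
      intro w hw
      have := (mem_pstack hpb (by omega) (by omega) _).1 hw
      omega
    obtain ⟨h', π'⟩ := s'
    have e := hp ⟨n, hnk⟩
    simp only at e
    change (h' = hs ∧ π' = (pb (d + n), hs ⟨n, hnk⟩) :: pstack pb p (d + n) ∧ _) ↔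
      (h', π') = (hs, (pb (d + n), p (d + n)) :: pstack pb p (d + n))
    rw [e, Prod.mk.injEq]
    exact ⟨fun h => ⟨h.1, h.2.1⟩, fun h => ⟨h.1, h.2, hfresh⟩⟩

theorem sem_retrP {p : ℕ → Pos t} {d : ℕ} {hs : Fin k → Pos t} (n : ℕ)
    (s' : (Fin k → Pos t) × List (X × Pos t)) :
    sem t (retrP pb d n) (hs, pstack pb p (d + n)) s' ↔ s' = (hs, pstack pb p d) := by
  induction n generalizing s' with
  | zero => exact eq_comm
  | succ n ih =>
    rw [← ih]
    constructor
    · rintro ⟨⟨m, π1⟩, ⟨e1, w, e2⟩, h2⟩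
      simp only at e1
      subst e1
      have e3 : pstack pb p (d + n) = π1 := (List.cons.inj e2).2
      rw [← e3] at h2
      exact h2
    · intro h
      exact ⟨(hs, pstack pb p (d + n)), ⟨rfl, _, rfl⟩, h⟩

theorem sem_placeP {M : ℕ} (hM : ∀ a, rank a ≤ M)
    (hpb : ∀ x < N, ∀ y < N, pb x = pb y → x = y) {p : ℕ → Pos t} {d : ℕ} (hd : d ≤ N)
    {f : Fin k → ℕ} (hf : ∀ i, f i < d)
    {hs : Fin k → Pos t} (s' : (Fin k → Pos t) × List (X × Pos t)) :
    sem t (placeP pb M f) (hs, pstack pb p d) s' ↔ s' = (fun i => p (f i), pstack pb p d) := by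
  rw [placeP, seqL_place (r := fun i u => u = p (f i)) _ _ (List.nodup_finRange k)]
  · obtain ⟨h', π'⟩ := s'
    simp only [List.mem_finRange, forall_const, not_true_eq_false, false_imp_iff, implies_true,
      and_true, Prod.mk.injEq, funext_iff]
    exact and_comm
  · intro i
    refine (HR.goto hM _).congr fun v u => ?_
    rw [mem_pstack hpb ((hf i).trans_le hd) hd]
    exact and_iff_right (hf i)

theorem sem_seqL_test {π : List (X × Pos t)} {f : Fin k → X} (L : List (Fin k))
    {hs : Fin k → Pos t} (s' : (Fin k → Pos t) × List (X × Pos t)) :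
    sem t (seqL (fun i => .ins (.test true (.peb i (f i)))) L) (hs, π) s' ↔
      s' = (hs, π) ∧ ∀ i ∈ L, (f i, hs i) ∈ π := by
  induction L generalizing s' with
  | nil => simp only [List.not_mem_nil, false_imp_iff, implies_true, and_true]; exact eq_comm
  | cons a L ih =>
    constructor
    · rintro ⟨⟨m, π1⟩, ⟨e1, e2, h1⟩, h2⟩
      simp only at e1 e2
      subst e1 e2
      obtain ⟨e, h3⟩ := (ih _).1 h2
      refine ⟨e, fun i hi => ?_⟩
      rcases List.mem_cons.1 hi with rfl | hi
      · exact h1.2 rfl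
      · exact h3 i hi
    · rintro ⟨rfl, h⟩
      refine ⟨(hs, π), ⟨rfl, rfl, ?_⟩, (ih _).2 ⟨rfl, fun i hi => h i (by simp [hi])⟩⟩
      exact ⟨fun _ => rfl, fun _ => h a (by simp)⟩

theorem sem_testP
    (hpb : ∀ x < N, ∀ y < N, pb x = pb y → x = y) {p : ℕ → Pos t} {d : ℕ} (hd : d ≤ N)
    {f : Fin k → ℕ} (hf : ∀ i, f i < d)
    {hs : Fin k → Pos t} (s' : (Fin k → Pos t) × List (X × Pos t)) :
    sem t (testP pb f) (hs, pstack pb p d) s' ↔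
      s' = (hs, pstack pb p d) ∧ hs = fun i => p (f i) := by
  rw [testP, sem_seqL_test, funext_iff]
  refine and_congr_right fun _ => ?_
  simp only [List.mem_finRange, forall_const]
  refine forall_congr' fun i => ?_
  rw [mem_pstack hpb ((hf i).trans_le hd) hd]
  exact and_iff_right (hf i)

/-- One step of the transitive closure. -/
def tcBody (pb : ℕ → X) (M d : ℕ) (T : Prog Sig k X) : Prog Sig k X :=
  .seq (dropP pb d k) (.seq (scr M) (.seq (dropP pb (d + k) k) (.seq T
    (.seq (placeP pb M fun i => d + k + i.1) (retrP pb d (k + k))))))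

/-- Transitive closure. -/
def tcP (pb : ℕ → X) (M d : ℕ) (us vs : Fin k → ℕ) (T : Prog Sig k X) : Prog Sig k X :=
  .seq (placeP pb M us) (.seq (.star (tcBody pb M d T)) (.seq (testP pb vs) (scr M)))

/-- Extended pebble placement. -/
def ext2 (p : ℕ → Pos t) (d : ℕ) (a b : Fin k → Pos t) (n : ℕ) : Pos t :=
  if h1 : d ≤ n ∧ n - d < k then a ⟨n - d, h1.2⟩
  else if h2 : d + k ≤ n ∧ n - (d + k) < k then b ⟨n - (d + k), h2.2⟩ else p n

theorem ext2_lt (p : ℕ → Pos t) {d : ℕ} (a b : Fin k → Pos t) {n : ℕ} (h : n < d) :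
    ext2 p d a b n = p n := by
  rw [ext2, dif_neg (by omega), dif_neg (by omega)]

theorem ext2_fst (p : ℕ → Pos t) (d : ℕ) (a b : Fin k → Pos t) (i : Fin k) :
    ext2 p d a b (d + i.1) = a i := by
  rw [ext2, dif_pos (by omega)]
  congr 1
  exact Fin.ext (by simp)

theorem ext2_snd (p : ℕ → Pos t) (d : ℕ) (a b : Fin k → Pos t) (i : Fin k) :
    ext2 p d a b (d + k + i.1) = b i := by
  rw [ext2, dif_neg (by omega), dif_pos (by omega)]
  congr 1
  exact Fin.ext (by simp)

theorem sem_tcBody {M : ℕ} (hM : ∀ a, rank a ≤ M)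
    (hpb : ∀ x < N, ∀ y < N, pb x = pb y → x = y) {p : ℕ → Pos t} {d : ℕ}
    (hd : d + k + k ≤ N) {T : Prog Sig k X} {Φ : (Fin k → Pos t) → (Fin k → Pos t) → Prop}
    (hT : ∀ a b, TS t (pstack pb (ext2 p d a b) (d + k + k)) T (Φ a b))
    (hs : Fin k → Pos t) (s' : (Fin k → Pos t) × List (X × Pos t)) :
    sem t (tcBody pb M d T) (hs, pstack pb p d) s' ↔ s'.2 = pstack pb p d ∧ Φ hs s'.1 := by
  have c1 : ∀ b, pstack pb p d = pstack pb (ext2 p d hs b) d := fun b =>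
    pstack_congr _ _ fun x hx => (ext2_lt p hs b hx).symm
  have c2 : ∀ b b', pstack pb (ext2 p d hs b) (d + k) = pstack pb (ext2 p d hs b') (d + k) := by
    intro b b'
    refine pstack_congr _ _ fun x hx => ?_
    by_cases hxd : x < d
    · rw [ext2_lt _ _ _ hxd, ext2_lt _ _ _ hxd]
    · rw [ext2, ext2, dif_pos (by omega), dif_pos (by omega)]
  have s1 : ∀ b s', sem t (dropP pb d k) (hs, pstack pb p d) s' ↔
      s' = (hs, pstack pb (ext2 p d hs b) (d + k)) := by
    intro b s'
    rw [c1 b]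
    exact sem_dropP hpb k le_rfl (by omega) (ext2_fst p d hs b) s'
  have s2 : ∀ b s', sem t (dropP pb (d + k) k) (b, pstack pb (ext2 p d hs b) (d + k)) s' ↔
      s' = (b, pstack pb (ext2 p d hs b) (d + k + k)) :=
    fun b s' => sem_dropP hpb k le_rfl (by omega) (ext2_snd p d hs b) s'
  have s3 : ∀ b h' s', sem t (placeP pb M fun i : Fin k => d + k + i.1)
      (h', pstack pb (ext2 p d hs b) (d + k + k)) s' ↔
      s' = (b, pstack pb (ext2 p d hs b) (d + k + k)) := by
    intro b h' s'
    rw [sem_placeP hM hpb hd (fun i => by omega)]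
    simp only [ext2_snd]
  have s4 : ∀ b s', sem t (retrP pb d (k + k) : Prog Sig k X)
      (b, pstack pb (ext2 p d hs b) (d + k + k)) s' ↔ s' = (b, pstack pb p d) := by
    intro b s'
    rw [c1 b, add_assoc d k k]
    exact sem_retrP _ _
  constructor
  · rintro ⟨m1, h1, ⟨b, π2⟩, h2, m3, h3, ⟨h4', π4⟩, h4, m5, h5, h6⟩
    rw [s1 hs] at h1
    subst h1
    rw [sem_scr hM] at h2
    simp only at h2
    subst h2
    rw [c2 hs b, s2] at h3
    subst h3
    obtain ⟨e, hΦ⟩ := (hT _ _ _ _).1 h4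
    simp only at e
    subst e
    rw [s3] at h5
    subst h5
    rw [s4] at h6
    subst h6
    exact ⟨rfl, hΦ⟩
  · obtain ⟨b, π'⟩ := s'
    rintro ⟨e, hΦ⟩
    simp only at e hΦ
    subst e
    exact ⟨_, (s1 b _).2 rfl, (b, _), (sem_scr hM _ _).2 rfl, _, (s2 b _).2 rfl,
      (b, _), (hT _ _ _ _).2 ⟨rfl, hΦ⟩, _, (s3 b _ _).2 rfl, (s4 b _).2 rfl⟩

theorem TS.tcP {M : ℕ} (hM : ∀ a, rank a ≤ M)
    (hpb : ∀ x < N, ∀ y < N, pb x = pb y → x = y) {p : ℕ → Pos t} {d : ℕ}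
    (hd : d + k + k ≤ N) {T : Prog Sig k X} {Φ : (Fin k → Pos t) → (Fin k → Pos t) → Prop}
    (hT : ∀ a b, TS t (pstack pb (ext2 p d a b) (d + k + k)) T (Φ a b)) {us vs : Fin k → ℕ}
    (hus : ∀ i, us i < d) (hvs : ∀ i, vs i < d) :
    TS t (pstack pb p d) (tcP pb M d us vs T)
      (Relation.ReflTransGen Φ (fun i => p (us i)) (fun i => p (vs i))) := by
  have hstar : ∀ hs s', sem t (.star (tcBody pb M d T)) (hs, pstack pb p d) s' ↔
      s'.2 = pstack pb p d ∧ Relation.ReflTransGen Φ hs s'.1 := by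
    intro hs s'
    constructor
    · intro h
      change Relation.ReflTransGen _ _ _ at h
      induction h with
      | refl => exact ⟨rfl, .refl⟩
      | @tail m s _ h2 ih =>
        obtain ⟨m, π1⟩ := m
        obtain ⟨e, h3⟩ := ih
        simp only at e
        subst e
        obtain ⟨e, h4⟩ := (sem_tcBody hM hpb hd hT _ _).1 h2
        exact ⟨e, h3.tail h4⟩
    · obtain ⟨b, π'⟩ := s'
      rintro ⟨e, h⟩
      simp only at e h
      subst e
      change Relation.ReflTransGen _ _ _
      induction h with
      | refl => exact .refl
      | @tail b c _ h2 ih =>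
        exact ih.tail ((sem_tcBody hM hpb hd hT _ _).2 ⟨rfl, h2⟩)
  intro hs s'
  have hd' : d ≤ N := by omega
  constructor
  · rintro ⟨m1, h1, ⟨m2, π2⟩, h2, m3, h3, h4⟩
    rw [sem_placeP hM hpb hd' hus] at h1
    subst h1
    obtain ⟨e, h5⟩ := (hstar _ _).1 h2
    simp only at e h5
    subst e
    rw [sem_testP hpb hd' hvs] at h3
    obtain ⟨rfl, rfl⟩ := h3
    exact ⟨(sem_scr hM _ _).1 h4, h5⟩
  · rintro ⟨e, h⟩
    exact ⟨_, (sem_placeP hM hpb hd' hus _).2 rfl, (_, pstack pb p d), (hstar _ _).2 ⟨rfl, h⟩, _,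
      (sem_testP hpb hd' hvs _).2 ⟨rfl, rfl⟩, (sem_scr hM _ _).2 e⟩

theorem comp_updVec {α β : Type} (g : α → β) (ν : ℕ → α) (xs : Fin k → ℕ) (a : Fin k → α) :
    (fun n => g (updVec ν xs a n)) = updVec (fun n => g (ν n)) xs (fun i => g (a i)) := by
  funext n
  unfold updVec
  split <;> rfl

end Compile
end NestedPebbles

namespace NestedPebbles
section Compile2
variable {Sig : Type} {rank : Sig → ℕ} {k : ℕ} {X : Type}

/-- The number of pebbles needed. -/
def need : TForm Sig rank k → ℕ
  | .not φ => need φ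
  | .and φ ψ => max (need φ) (need ψ)
  | .or φ ψ => max (need φ) (need ψ)
  | .ex _ φ => need φ + 1
  | .all _ φ => need φ + 1
  | .tc _ _ φ _ _ => need φ + k + k
  | _ => 0

/-- Negative edge test. -/
def edgF (M : ℕ) (z : Fin k) (i : ℕ) (x y : X) : Prog Sig k X :=
  .seq (goto M z y) (.alt (.ins (.test false (.chno z i))) (.alt (.ins (.test true (.chno z 0)))
    (.seq (.ins (.up z)) (.ins (.test false (.peb z x))))))

/-- Negative ancestor test. -/
def leF (M : ℕ) (z : Fin k) (x y : X) : Prog Sig k X :=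
  .seq (goto M z y) (.seq (.star (.seq (.ins (.test false (.peb z x))) (.ins (.up z))))
    (.seq (.ins (.test false (.peb z x))) (.ins (.test true (.chno z 0)))))

/-- Compilation of formulas to programs. -/
noncomputable def comp (pb : ℕ → X) (L : List Sig) (M : ℕ) (z : Fin k) :
    TForm Sig rank k → Bool → ℕ → (ℕ → ℕ) → Prog Sig k X
  | .lab a x, b, _, env =>
    .seq (.seq (goto M z (pb (env x))) (.ins (.test b (.lab z a)))) (scr M)
  | .edg i x y, true, _, env =>
    .seq (.seq (goto M z (pb (env x)))
      (.seq (.ins (.down z i)) (.ins (.test true (.peb z (pb (env y))))))) (scr M)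
  | .edg i x y, false, _, env => .seq (edgF M z i (pb (env x)) (pb (env y))) (scr M)
  | .le x y, true, _, env =>
    .seq (.seq (goto M z (pb (env y)))
      (.seq (.star (.ins (.up z))) (.ins (.test true (.peb z (pb (env x))))))) (scr M)
  | .le x y, false, _, env => .seq (leF M z (pb (env x)) (pb (env y))) (scr M)
  | .eq x y, b, _, env =>
    .seq (.seq (goto M z (pb (env x))) (.ins (.test b (.peb z (pb (env y)))))) (scr M)
  | .not φ, b, d, env => comp pb L M z φ (!b) d env
  | .and φ ψ, true, d, env => .seq (comp pb L M z φ true d env) (comp pb L M z ψ true d env)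
  | .and φ ψ, false, d, env => .alt (comp pb L M z φ false d env) (comp pb L M z ψ false d env)
  | .or φ ψ, true, d, env => .alt (comp pb L M z φ true d env) (comp pb L M z ψ true d env)
  | .or φ ψ, false, d, env => .seq (comp pb L M z φ false d env) (comp pb L M z ψ false d env)
  | .ex x φ, true, d, env =>
    exP M z (pb d) (comp pb L M z φ true (d + 1) (Function.update env x d))
  | .ex x φ, false, d, env =>
    allP rank L M z (pb d) (comp pb L M z φ false (d + 1) (Function.update env x d))
  | .all x φ, true, d, env =>
    allP rank L M z (pb d) (comp pb L M z φ true (d + 1) (Function.update env x d))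
  | .all x φ, false, d, env =>
    exP M z (pb d) (comp pb L M z φ false (d + 1) (Function.update env x d))
  | .tc xs ys φ us vs, _, d, env =>
    tcP pb M d (fun i => env (us i)) (fun i => env (vs i)) (comp pb L M z φ true (d + k + k)
      (updVec (updVec env xs fun i => d + i.1) ys fun i => d + k + i.1))

variable {t : RTree Sig rank} {π : List (X × Pos t)} {z : Fin k}

theorem TS.edgF {M : ℕ} (hM : ∀ a, rank a ≤ M) {x y : X} {a b : Pos t}
    (hx : ∀ u, (x, u) ∈ π ↔ u = a) (hy : ∀ u, (y, u) ∈ π ↔ u = b) (i : ℕ) :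
    TS t π (.seq (edgF M z i x y) (scr M)) (¬ (1 ≤ i ∧ b.1 = a.1 ++ [i - 1])) := by
  refine ((HR.goto hM y).seq ((HR.chno false i).alt ((HR.chno true 0).alt
    (HR.up.seq (HR.peb false x))))).toWR.toTS hM fun v => ?_
  simp only [hx, hy, exists_eq_left]
  constructor
  · rintro ⟨u, ⟨-, h⟩ | ⟨-, h⟩ | ⟨m, ⟨j, hj⟩, -, h⟩⟩ ⟨h1, h2⟩
    · rw [h2, childNo_snoc] at h
      simp at h
      omega
    · rw [h2, childNo_snoc] at h
      simp at h
    · rw [h2] at hj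
      have := (List.append_inj' hj rfl).1
      exact absurd (h.1 (pos_ext this.symm)) (by simp)
  · intro h
    by_cases h0 : childNo b.1 = 0
    · exact ⟨b, Or.inr (Or.inl ⟨rfl, by simp [h0]⟩)⟩
    by_cases h1 : childNo b.1 = i
    · obtain ⟨j, hj⟩ := Nat.exists_eq_succ_of_ne_zero h0
      obtain ⟨w, hw⟩ := childNo_succ.1 hj
      have hp : IsPos t w := isPos_of_append (q := [j]) (hw ▸ b.2)
      refine ⟨mkPos w hp, Or.inr (Or.inr ⟨mkPos w hp, ⟨j, hw⟩, rfl, ?_⟩)⟩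
      constructor
      · intro e
        exact absurd ⟨by omega, by rw [hw, ← e, ← h1, hj]; rfl⟩ h
      · simp
    · exact ⟨b, Or.inl ⟨rfl, by simp [h1]⟩⟩

theorem walk_pre {a b m : Pos t}
    (h : Relation.ReflTransGen (fun v u : Pos t => v ≠ a ∧ ∃ j, v.1 = u.1 ++ [j]) b m)
    (hab : a.1 <+: b.1) : a.1 <+: m.1 := by
  induction h with
  | refl => exact hab
  | tail _ h' ih =>
    obtain ⟨hne, j, hj⟩ := h'
    rw [hj] at ih
    rcases List.prefix_concat_iff.1 ih with e | e
    · exact absurd (pos_ext (hj.trans e.symm)) hne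
    · exact e

theorem walk_root {a : Pos t} (w : List ℕ) : ∀ b : Pos t, b.1 = w → ¬ a.1 <+: b.1 →
    Relation.ReflTransGen (fun v u : Pos t => v ≠ a ∧ ∃ j, v.1 = u.1 ++ [j]) b (rootPos t) := by
  induction w using List.reverseRecOn with
  | nil =>
    intro b hb _
    rw [show b = rootPos t from pos_ext hb]
  | append_singleton w j ih =>
    intro b hb hab
    have hp : IsPos t w := isPos_of_append (q := [j]) (hb ▸ b.2)
    refine .head (b := mkPos w hp) ⟨?_, j, hb⟩ (ih _ rfl fun h => hab ?_)
    · rintro rfl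
      exact hab List.prefix_rfl
    · rw [hb]
      exact List.IsPrefix.trans h (List.prefix_append _ _)

theorem TS.leF {M : ℕ} (hM : ∀ a, rank a ≤ M) {x y : X} {a b : Pos t}
    (hx : ∀ u, (x, u) ∈ π ↔ u = a) (hy : ∀ u, (y, u) ∈ π ↔ u = b) :
    TS t π (.seq (leF M z x y) (scr M)) (¬ a.1 <+: b.1) := by
  refine ((HR.goto hM y).seq (((HR.peb false x).seq HR.up).star.seq ((HR.peb false x).seq
    (HR.chno true 0)))).toWR.toTS hM fun v => ?_
  have e : (fun v u : Pos t => ∃ m, (m = v ∧ ((x, v) ∈ π ↔ false = true)) ∧ ∃ j, m.1 = u.1 ++ [j])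
      = fun v u => v ≠ a ∧ ∃ j, v.1 = u.1 ++ [j] := by
    funext v u
    simp [hx]
  rw [e]
  simp only [hx, hy, exists_eq_left]
  constructor
  · rintro ⟨u, m, h, m', ⟨rfl, h1⟩, -, h2⟩ hab
    have hm : m' = rootPos t := pos_ext (childNo_zero.1 (by simpa using h2))
    subst hm
    have ha : (rootPos t) = a := pos_ext (List.prefix_nil.1 (walk_pre h hab)).symm
    exact absurd (h1.1 ha) (by simp)
  · intro h
    refine ⟨rootPos t, rootPos t, walk_root _ b rfl h, rootPos t, ⟨rfl, ?_⟩, rfl, by simp [rootPos]⟩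
    constructor
    · intro e
      exact absurd (e ▸ nil_pre) h
    · simp

/-- Valuation of the bound variables. -/
theorem update_env {p : ℕ → Pos t} {d : ℕ} {env : ℕ → ℕ} (henv : ∀ n, env n < d) (x : ℕ)
    (u : Pos t) : (fun n => Function.update p d u (Function.update env x d n)) =
      Function.update (fun n => p (env n)) x u := by
  funext n
  by_cases hn : n = x
  · subst hn; simp
  · rw [Function.update_of_ne hn, Function.update_of_ne hn,
      Function.update_of_ne (henv n).ne]

theorem ext2_env {p : ℕ → Pos t} {d : ℕ} {env : ℕ → ℕ} (henv : ∀ n, env n < d)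
    (xs ys : Fin k → ℕ) (a b : Fin k → Pos t) :
    (fun n => ext2 p d a b
      (updVec (updVec env xs fun i => d + i.1) ys (fun i => d + k + i.1) n)) =
      updVec (updVec (fun n => p (env n)) xs a) ys b := by
  rw [comp_updVec, comp_updVec]
  simp only [ext2_fst, ext2_snd, ext2_lt _ _ _ (henv _)]

theorem updVec_lt {ν : ℕ → ℕ} {xs a : Fin k → ℕ} {D : ℕ} (h : ∀ n, ν n < D) (h' : ∀ i, a i < D)
    (n : ℕ) : updVec ν xs a n < D := by
  unfold updVec
  split
  · exact h' _
  · exact h _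

theorem comp_spec {pb : ℕ → X} {N : ℕ} (hpb : ∀ x < N, ∀ y < N, pb x = pb y → x = y)
    {L : List Sig} (hL : ∀ a, a ∈ L) {M : ℕ} (hM : ∀ a, rank a ≤ M) (z : Fin k)
    (t : RTree Sig rank) (φ : TForm Sig rank k) : ∀ (b : Bool) (d : ℕ) (env : ℕ → ℕ)
    (p : ℕ → Pos t), PosTC b φ → d + need φ ≤ N → (∀ n, env n < d) →
    TS t (pstack pb p d) (comp pb L M z φ b d env)
      (Sat t φ (fun n => p (env n)) ↔ b = true) := by
  have mem : ∀ {d : ℕ} {env : ℕ → ℕ} {p : ℕ → Pos t}, d ≤ N → (∀ n, env n < d) → ∀ x u,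
      (pb (env x), u) ∈ pstack pb p d ↔ u = p (env x) := by
    intro d env p hd henv x u
    rw [mem_pstack hpb ((henv x).trans_le hd) hd]
    exact and_iff_right (henv x)
  -- the quantifier step
  have quant : ∀ (x : ℕ) (φ : TForm Sig rank k), (∀ (b : Bool) (d : ℕ) (env : ℕ → ℕ)
      (p : ℕ → Pos t), PosTC b φ → d + need φ ≤ N → (∀ n, env n < d) →
      TS t (pstack pb p d) (comp pb L M z φ b d env)
        (Sat t φ (fun n => p (env n)) ↔ b = true)) →
      ∀ (b : Bool) (d : ℕ) (env : ℕ → ℕ)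
      (p : ℕ → Pos t), PosTC b φ → d + (need φ + 1) ≤ N → (∀ n, env n < d) →
      (∀ w, (pb d, w) ∉ pstack pb p d) ∧
      ∀ u, TS t ((pb d, u) :: pstack pb p d)
        (comp pb L M z φ b (d + 1) (Function.update env x d))
        (Sat t φ (Function.update (fun n => p (env n)) x u) ↔ b = true) := by
    intro x φ ih b d env p hφ hN henv
    refine ⟨fun w hw => ?_, fun u => ?_⟩
    · have := (mem_pstack hpb (by omega) (by omega) _).1 hw
      omega
    · have h := ih b (d + 1) (Function.update env x d) (Function.update p d u) hφ (by omega) ?_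
      · rw [update_env henv] at h
        have e : pstack pb (Function.update p d u) (d + 1) = (pb d, u) :: pstack pb p d := by
          simp only [pstack, Function.update_self]
          rw [pstack_congr pb (p' := p) d fun y hy => Function.update_of_ne hy.ne _ _]
        rwa [e] at h
      · intro n
        by_cases hn : n = x
        · subst hn; simp
        · rw [Function.update_of_ne hn]; have := henv n; omega
  induction φ with
  | lab a x =>
    intro b d env p _ hN henv
    simp only [need] at hN
    refine ((HR.goto hM _).seq (HR.lab b a)).toWR.toTS hM fun v => ?_
    simp [mem (d := d) (env := env) (p := p) hN henv, Sat]
  | eq x y =>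
    intro b d env p _ hN henv
    simp only [need] at hN
    refine ((HR.goto hM _).seq (HR.peb b _)).toWR.toTS hM fun v => ?_
    simp [mem (d := d) (env := env) (p := p) hN henv, Sat]
  | edg i x y =>
    intro b d env p _ hN henv
    simp only [need] at hN
    cases b with
    | true =>
      refine ((HR.goto hM _).seq ((HR.down i).seq (HR.peb true _))).toWR.toTS hM fun v => ?_
      simp [mem (d := d) (env := env) (p := p) hN henv, Sat]
    | false =>
      refine (TS.edgF (z := z) hM (mem (d := d) (env := env) (p := p) hN henv x) (mem (d := d) (env := env) (p := p) hN henv y) i).congr ?_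
      simp [Sat]
  | le x y =>
    intro b d env p _ hN henv
    simp only [need] at hN
    cases b with
    | true =>
      refine ((HR.goto hM _).seq (HR.up.star.seq (HR.peb true _))).toWR.toTS hM fun v => ?_
      simp [mem (d := d) (env := env) (p := p) hN henv, Sat, ups_iff]
    | false =>
      refine (TS.leF (z := z) hM (mem (d := d) (env := env) (p := p) hN henv x) (mem (d := d) (env := env) (p := p) hN henv y)).congr ?_
      simp [Sat]
  | not φ ih =>
    intro b d env p hφ hN henv
    refine (ih (!b) d env p hφ hN henv).congr ?_
    cases b <;> simp [Sat]
  | and φ ψ ih1 ih2 =>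
    intro b d env p hφ hN henv
    simp only [need] at hN
    have h1 := ih1 b d env p hφ.1 (by omega) henv
    have h2 := ih2 b d env p hφ.2 (by omega) henv
    cases b with
    | true => exact (h1.and h2).congr (by simp [Sat])
    | false => exact (h1.or h2).congr (by simp only [Sat]; simp; tauto)
  | or φ ψ ih1 ih2 =>
    intro b d env p hφ hN henv
    simp only [need] at hN
    have h1 := ih1 b d env p hφ.1 (by omega) henv
    have h2 := ih2 b d env p hφ.2 (by omega) henv
    cases b with
    | true => exact (h1.or h2).congr (by simp [Sat])
    | false => exact (h1.and h2).congr (by simp [Sat])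
  | ex x φ ih =>
    intro b d env p hφ hN henv
    obtain ⟨hf, hT⟩ := quant x φ ih b d env p hφ hN henv
    cases b with
    | true => exact (TS.exP (i := z) hM hf hT).congr (by simp [Sat])
    | false => exact (TS.allP (i := z) hL hM hf hT).congr (by simp [Sat])
  | all x φ ih =>
    intro b d env p hφ hN henv
    obtain ⟨hf, hT⟩ := quant x φ ih b d env p hφ hN henv
    cases b with
    | true => exact (TS.allP (i := z) hL hM hf hT).congr (by simp [Sat])
    | false => exact (TS.exP (i := z) hM hf hT).congr (by simp [Sat])
  | tc xs ys φ us vs ih =>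
    intro b d env p hφ hN henv
    obtain ⟨rfl, hφ⟩ := hφ
    simp only [need] at hN
    have hT : ∀ a b : Fin k → Pos t, TS t (pstack pb (ext2 p d a b) (d + k + k))
        (comp pb L M z φ true (d + k + k)
          (updVec (updVec env xs fun i => d + i.1) ys fun i => d + k + i.1))
        (Sat t φ (updVec (updVec (fun n => p (env n)) xs a) ys b)) := by
      intro a b
      refine (ih true (d + k + k) _ (ext2 p d a b) hφ (by omega) ?_).congr ?_
      · refine updVec_lt (updVec_lt (fun n => ?_) fun i => ?_) fun i => ?_
        · have := henv n; omega
        · omega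
        · omega
      · rw [ext2_env henv]; simp
    refine (TS.tcP hM hpb (by omega) hT (fun i => henv (us i)) (fun i => henv (vs i))).congr ?_
    simp only [Sat, iff_true]

theorem fo_accepts [Fintype Sig] (hk : 1 ≤ k) (φ : TForm Sig rank k) (hφ : PosTC true φ) :
    ∃ A : TWA Sig rank k, treesOf φ = Lang A := by
  obtain ⟨M, hM⟩ := exists_maxRank rank
  let z : Fin k := ⟨0, hk⟩
  let N := 1 + need φ
  let pb : ℕ → Fin (N + 1) := fun n => Fin.ofNat (N + 1) n
  have hpb : ∀ x < N, ∀ y < N, pb x = pb y → x = y := by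
    intro x hx y hy h
    have h' := congrArg Fin.val h
    simp only [pb, Fin.val_ofNat] at h'
    rwa [Nat.mod_eq_of_lt (by omega), Nat.mod_eq_of_lt (by omega)] at h'
  let T : Prog Sig k (Fin (N + 1)) := comp pb Finset.univ.toList M z φ true 1 (fun _ => 0)
  refine ⟨progAut rank z (withPeb z (pb 0) T), ?_⟩
  ext t
  change Sat t φ (fun _ => rootPos t) ↔ Accepts _ t
  rw [progAut_accepts]
  have h := comp_spec hpb (L := Finset.univ.toList) (by simp) hM z t φ true 1 (fun _ => 0)
    (fun _ => rootPos t) hφ le_rfl (fun _ => Nat.one_pos)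
  rw [sem_withPeb (R := fun _ => Sat t φ (fun _ => rootPos t)) (by simp)]
  · simp
  · intro s'
    refine (h _ s').trans ?_
    simp [pstack]

end Compile2
end NestedPebbles


namespace NestedPebbles

/-- `NPTWA^k = FO+posTC^k`: nondeterministic `k`-head
tree-walking automata with nested pebbles accept exactly the tree languages
definable in first-order logic with positive occurrences of `k`-ary transitive
closure. -/
theorem NPTWA_eq_FOposTC (Sig : Type) [Fintype Sig] (rank : Sig → ℕ)
    (k : ℕ) (hk : 1 ≤ k) :
    NPTWA Sig rank k = FOposTC Sig rank k := by
  
  ext S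
  constructor
  · rintro ⟨A, rfl⟩
    exact accepts_def hk A
  · rintro ⟨φ, -, hφ, -, rfl⟩
    exact fo_accepts hk φ hφ

end NestedPebbles
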